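/- Let f₁(x) = (x² − x − 1)⁵·(x² − x − 1/16) − (25/4)·x³·(x − 1)³·(x³ − 2) ∈ ℚ[x]. Then f₁ is irreducible over ℚ, the Galois group of its splitting field over ℚ is a simple group of cardinality 7920 (i.e., isomorphic to the Mathieu group M₁₁), and the root field K = ℚ[x]/(f₁) is a degree-12 number field with discriminant 2⁸·3¹²·5¹⁰·11⁶; in particular K/ℚ is ramified only above the primes 2, 3, 5, 11, which are exactly the prime divisors of |M₁₁| = 7920. -/

import Mathlib

open Polynomial

/-- `f₁(x) = (x² − x − 1)⁵ (x² − x − 1/16) − (25/4) · x³ (x − 1)³ (x³ − 2)` over `ℚ`. -/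
noncomputable def f1 : Polynomial ℚ :=
  (X ^ 2 - X - 1) ^ 5 * (X ^ 2 - X - C (1 / 16 : ℚ)) -
    C (25 / 4 : ℚ) * (X ^ 3 * (X - 1) ^ 3 * (X ^ 3 - 2))


open Polynomial

namespace M11

section lists
variable {R : Type*} [CommRing R]

/-- evaluate an integer coefficient list at `y` -/
def ev (y : R) : List ℤ → R
  | [] => 0
  | c :: l => (c : R) + y * ev y l

def addL : List ℤ → List ℤ → List ℤ
  | [], l => l
  | l, [] => l
  | a :: l, b :: m => (a + b) :: addL l m

def smulL (c : ℤ) (l : List ℤ) : List ℤ := l.map (c * ·)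

def mulL : List ℤ → List ℤ → List ℤ
  | [], _ => []
  | a :: l, m => addL (smulL a m) (0 :: mulL l m)

/-- multiply by the variable modulo `y ^ n = rel`. -/
def mulX (n : ℕ) (rel l : List ℤ) : List ℤ :=
  addL ((0 :: l).take n) (mulL ((0 :: l).drop n) rel)

/-- product modulo `y ^ n = rel`. -/
def mulM (n : ℕ) (rel : List ℤ) : List ℤ → List ℤ → List ℤ
  | [], _ => []
  | a :: l, m => addL (smulL a m) (mulX n rel (mulM n rel l m))

def modL (p : ℤ) (l : List ℤ) : List ℤ := l.map (· % p)

@[simp] theorem ev_nil (y : R) : ev y [] = 0 := rfl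
@[simp] theorem ev_cons (y : R) (c : ℤ) (l : List ℤ) : ev y (c :: l) = c + y * ev y l := rfl

theorem ev_addL (y : R) (l m : List ℤ) : ev y (addL l m) = ev y l + ev y m := by
  induction l generalizing m with
  | nil => simp [addL]
  | cons a l ih =>
    cases m with
    | nil => simp [addL]
    | cons b m => simp [addL, ih]; ring

theorem ev_smulL (y : R) (c : ℤ) (l : List ℤ) : ev y (smulL c l) = c * ev y l := by
  induction l with
  | nil => simp [smulL]
  | cons a l ih =>
    have : smulL c (a :: l) = (c * a) :: smulL c l := rfl
    rw [this, ev_cons, ih]; push_cast; simp; ring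

theorem ev_mulL (y : R) (l m : List ℤ) : ev y (mulL l m) = ev y l * ev y m := by
  induction l with
  | nil => simp [mulL]
  | cons a l ih => simp [mulL, ev_addL, ev_smulL, ih]; ring

theorem ev_take_drop (y : R) (n : ℕ) (l : List ℤ) :
    ev y (l.take n) + y ^ n * ev y (l.drop n) = ev y l := by
  induction n generalizing l with
  | zero => simp
  | succ n ih =>
    cases l with
    | nil => simp
    | cons a l => rw [List.take_succ_cons, List.drop_succ_cons, ev_cons, ev_cons, ← ih l]; ring

theorem ev_mulX (y : R) (n : ℕ) (rel l : List ℤ) (h : y ^ n = ev y rel) :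
    ev y (mulX n rel l) = y * ev y l := by
  have := ev_take_drop y n (0 :: l)
  rw [mulX, ev_addL, ev_mulL, mul_comm (ev y (List.drop n (0 :: l))), ← h, this]; simp

theorem ev_mulM (y : R) (n : ℕ) (rel l m : List ℤ) (h : y ^ n = ev y rel) :
    ev y (mulM n rel l m) = ev y l * ev y m := by
  induction l with
  | nil => simp [mulM]
  | cons a l ih => simp [mulM, ev_addL, ev_smulL, ev_mulX y n rel _ h, ih]; ring

theorem ev_modL (y : R) (p : ℕ) (hp : (p : R) = 0) (l : List ℤ) : ev y (modL p l) = ev y l := by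
  induction l with
  | nil => rfl
  | cons a l ih =>
    have h2 : modL p (a :: l) = (a % p) :: modL p l := rfl
    rw [h2, ev_cons, ih, ev_cons]
    congr 1
    conv_rhs => rw [← Int.emod_add_mul_ediv a p]
    push_cast; rw [hp]; ring

/-- `f` commutes with evaluation -/
theorem map_ev {S : Type*} [CommRing S] (f : R →+* S) (y : R) (l : List ℤ) :
    f (ev y l) = ev (f y) l := by
  induction l with
  | nil => simp
  | cons a l ih => simp [ih]

/-- polynomial with coefficient list -/
noncomputable def toP (R : Type*) [CommRing R] (l : List ℤ) : R[X] := ev (X : R[X]) l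

theorem eval_toP (y : R) (l : List ℤ) : (toP R l).eval y = ev y l := by
  have := map_ev (Polynomial.evalRingHom y) X l
  simpa [toP] using this

theorem aeval_toP {A : Type*} [CommRing A] [Algebra R A] (y : A) (l : List ℤ) :
    aeval y (toP R l) = ev y l := by
  have := map_ev ((Polynomial.aeval y : R[X] →ₐ[R] A) : R[X] →+* A) X l
  simpa [toP] using this

theorem map_toP {S : Type*} [CommRing S] (f : R →+* S) (l : List ℤ) :
    (toP R l).map f = toP S l := by
  have := map_ev (Polynomial.mapRingHom f) X l
  simpa [toP] using this

/-- bivariate lists: coefficients (in `x`) are lists (in `y`) -/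
def ev2 (x y : R) : List (List ℤ) → R
  | [] => 0
  | c :: l => ev y c + x * ev2 x y l

def addB : List (List ℤ) → List (List ℤ) → List (List ℤ)
  | [], l => l
  | l, [] => l
  | a :: l, b :: m => addL a b :: addB l m

def mulB (n : ℕ) (rel : List ℤ) : List (List ℤ) → List (List ℤ) → List (List ℤ)
  | [], _ => []
  | a :: l, m => addB (m.map (mulM n rel a)) ([] :: mulB n rel l m)

@[simp] theorem ev2_nil (x y : R) : ev2 x y [] = 0 := rfl
@[simp] theorem ev2_cons (x y : R) (c : List ℤ) (l) :
    ev2 x y (c :: l) = ev y c + x * ev2 x y l := rfl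

theorem ev2_addB (x y : R) (l m : List (List ℤ)) : ev2 x y (addB l m) = ev2 x y l + ev2 x y m := by
  induction l generalizing m with
  | nil => simp [addB]
  | cons a l ih =>
    cases m with
    | nil => simp [addB]
    | cons b m => simp [addB, ih, ev_addL]; ring

theorem ev2_map_mulM (x y : R) (n : ℕ) (rel : List ℤ) (h : y ^ n = ev y rel) (a : List ℤ)
    (m : List (List ℤ)) : ev2 x y (m.map (mulM n rel a)) = ev y a * ev2 x y m := by
  induction m with
  | nil => simp
  | cons b m ih => simp [ih, ev_mulM y n rel _ _ h]; ring

theorem ev2_mulB (x y : R) (n : ℕ) (rel : List ℤ) (h : y ^ n = ev y rel)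
    (l m : List (List ℤ)) : ev2 x y (mulB n rel l m) = ev2 x y l * ev2 x y m := by
  induction l with
  | nil => simp [mulB]
  | cons a l ih => simp [mulB, ev2_addB, ev2_map_mulM x y n rel h, ih]; ring

theorem map_ev2 {S : Type*} [CommRing S] (f : R →+* S) (x y : R) (l : List (List ℤ)) :
    f (ev2 x y l) = ev2 (f x) (f y) l := by
  induction l with
  | nil => simp
  | cons a l ih => simp [ih, map_ev]

/-- embed a univariate list in `x` as a bivariate list -/
def constB (l : List ℤ) : List (List ℤ) := l.map fun c => [c]

theorem ev2_constB (x y : R) (l : List ℤ) : ev2 x y (constB l) = ev x l := by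
  induction l with
  | nil => rfl
  | cons a l ih =>
    have : constB (a :: l) = [a] :: constB l := rfl
    rw [this, ev2_cons, ih]; simp

end lists
end M11

namespace M11

/-- bit masks: bit `j` of entry `i` tells on which side of the `j`-th pair of hexads `i` lies -/
def hex : List ℕ := [0, 1596, 1179, 1635, 311, 1925, 1358, 938, 1520, 857, 726, 237]

def col (i : Fin 12) : ℕ := hex.getD i 0

def mem (j : Fin 11) (i : Fin 12) : Bool := (col i).testBit j

/-- `i` and `i'` are on the same side of the `j`-th pair of complementary hexads -/
def R (j : Fin 11) (i i' : Fin 12) : Bool := mem j i == mem j i'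

def Pres (τ : Equiv.Perm (Fin 12)) : Prop :=
  ∀ j, ∃ j', ∀ i i', R j i i' = R j' (τ i) (τ i')

/-- candidates for the image of the `j`-th pair -/
def cand (j : Fin 11) : List (Fin 12) → List (Fin 12) → ℕ
  | x :: xs, t :: ts => (if mem j x then col t else 2047 - col t) &&& cand j xs ts
  | _, _ => 2047

def pts (k : ℕ) : List (Fin 12) := (List.finRange 12).take k

def okL (k : ℕ) (l : List (Fin 12)) : Bool :=
  (List.finRange 11).all fun j => !(Nat.beq (cand j (pts k) l) 0)

def extL (k : ℕ) (L : List (List (Fin 12))) : List (List (Fin 12)) :=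
  (L.flatMap fun l => ((List.finRange 12).filter fun t => !(l.contains t)).map fun t => l ++ [t]).filter (okL k)

def lev : ℕ → List (List (Fin 12))
  | 0 => [[0, 1]]
  | k + 1 => extL (k + 3) (lev k)

set_option maxRecDepth 100000 in
theorem lev10 : (lev 10).length = 60 := by decide +kernel

theorem pres_col : (∀ t : Fin 12, t ≠ 0 → ∃ i, ∀ s, ∃ j, R j i 0 ≠ R j s t) ∧
   (∀ i s : Fin 12, (∀ j, R j i 0 = R j s 0) → s = i) := by decide +kernel

theorem row_uniq : ∀ j j' : Fin 11, (∀ i i', R j i i' = R j' i i') → j = j' := by decide +kernel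
end M11

namespace M11
open Subgroup

theorem sylow11 {G : Type*} [Group G] [Finite G] (c : G) (hc : orderOf c = 11)
    (hcent : ∀ g, Commute g c → g ∈ zpowers c) (m : ℕ) (hm : Nat.card G = 132 * m)
    (h30 : 30 ∣ m) (hm60 : m ≤ 60) :
    Nat.card G = 7920 ∧ ∃ P : Sylow 11 G, Nat.card P = 11 ∧ Nat.card (normalizer (P : Set G)) = 55 := by
  have : Fact (Nat.Prime 11) := ⟨by norm_num⟩
  have hcard : Nat.card (zpowers c) = 11 := by rw [Nat.card_zpowers, hc]
  have hpos : 0 < Nat.card G := Nat.card_pos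
  have hm' : m = 30 ∨ m = 60 := by omega
  have hidx : (zpowers c).index = 12 * m := by
    have := (zpowers c).card_mul_index
    rw [hcard, hm] at this; omega
  have hnd : ¬ 11 ∣ (zpowers c).index := by
    rw [hidx]; rcases hm' with rfl | rfl <;> decide
  have hpg : IsPGroup 11 (zpowers c) := IsPGroup.of_card (n := 1) (by rw [hcard]; rfl)
  let P : Sylow 11 G := hpg.toSylow hnd
  have hPc : (P : Subgroup G) = zpowers c := rfl
  have hn := P.card_eq_index_normalizer
  have hmod := card_sylow_modEq_one 11 G
  have hnm := (normalizer (P : Set G)).card_mul_index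
  rw [← hn, hm] at hnm
  -- N/C
  have hle : (zpowers c) ≤ normalizer (zpowers c : Set G) := le_normalizer
  have hker : ((zpowers c).normalizerMonoidHom).ker = (zpowers c).subgroupOf (normalizer (zpowers c : Set G)) := by
    rw [normalizerMonoidHom_ker]
    ext x
    simp only [mem_subgroupOf]
    constructor
    · intro h
      refine hcent _ ?_
      rw [mem_centralizer_iff] at h
      exact (h c (mem_zpowers c)).symm
    · intro h
      rw [mem_centralizer_iff]
      intro y hy
      obtain ⟨i, hi⟩ := mem_zpowers_iff.1 h
      obtain ⟨j, hj⟩ := mem_zpowers_iff.1 hy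
      rw [← hi, ← hj, ← zpow_add, ← zpow_add, add_comm]
  have hkc : Nat.card ((zpowers c).normalizerMonoidHom).ker = 11 := by
    rw [hker, Nat.card_congr (subgroupOfEquivOfLe hle).toEquiv, hcard]
  have hrange : Nat.card ((zpowers c).normalizerMonoidHom).range ∣ 10 := by
    have h1 := Subgroup.card_subgroup_dvd_card ((zpowers c).normalizerMonoidHom).range
    rw [IsCyclic.card_mulAut, hcard] at h1
    have : Nat.totient 11 = 10 := by decide
    rwa [this] at h1
  have hprod : Nat.card (normalizer (zpowers c : Set G)) = 11 * Nat.card ((zpowers c).normalizerMonoidHom).range := by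
    rw [← hkc, ← Subgroup.card_mul_index ((zpowers c).normalizerMonoidHom).ker, Subgroup.index_ker]
  obtain ⟨j, hj⟩ : ∃ j, j = Nat.card ((zpowers c).normalizerMonoidHom).range := ⟨_, rfl⟩
  rw [← hj] at hprod hrange
  have hPn : Nat.card (normalizer (P : Set G)) = 11 * j := hprod
  rw [hPn] at hnm
  obtain ⟨s, hs⟩ : ∃ s, s = Nat.card (Sylow 11 G) := ⟨_, rfl⟩
  rw [← hs] at hnm hmod
  have hj10 : j ≤ 10 := Nat.le_of_dvd (by norm_num) hrange
  have hmod' : s % 11 = 1 := hmod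
  have key : m = 60 ∧ j = 5 := by
    rcases hm' with rfl | rfl <;> interval_cases j <;> omega
  obtain ⟨rfl, rfl⟩ := key
  exact ⟨hm, P, hcard, hPn⟩

theorem simple7920 {G : Type*} [Group G] [Finite G] (hG : Nat.card G = 7920)
    (P : Sylow 11 G) (hP : Nat.card P = 11) (hN : Nat.card (normalizer (P : Set G)) = 55)
    (h11 : ∀ N : Subgroup G, N.Normal → N ≠ ⊥ → 11 ∣ Nat.card N) : IsSimpleGroup G := by
  have : Fact (Nat.Prime 11) := ⟨by norm_num⟩
  have : Nontrivial G := Finite.one_lt_card_iff_nontrivial.1 (by rw [hG]; norm_num)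
  have hs : Nat.card (Sylow 11 G) = 144 := by
    have h1 := P.card_eq_index_normalizer
    have h2 := (normalizer (P : Set G)).card_mul_index
    rw [hN, hG, ← h1] at h2; omega
  refine ⟨fun N hNn => ?_⟩
  by_contra! hcon
  obtain ⟨hbot, htop⟩ := hcon
  have hd := h11 N hNn hbot
  have hPN : (P : Subgroup G) ≤ N := by
    obtain ⟨x, hx⟩ := exists_prime_orderOf_dvd_card' (G := N) 11 hd
    have hx' : orderOf (x : G) = 11 := by rw [Subgroup.orderOf_coe, hx]
    have hpg : IsPGroup 11 (zpowers (x : G)) := IsPGroup.of_card (n := 1) (by rw [Nat.card_zpowers, hx']; rfl)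
    obtain ⟨Q, hQ⟩ := hpg.exists_le_sylow
    have hcQ : Nat.card Q = 11 := by
      exact (Nat.card_congr (Q.equiv P).toEquiv).trans hP
    have hQx : zpowers (x : G) = Q := Subgroup.eq_of_le_of_card_ge hQ (by
      rw [Nat.card_zpowers, hx', hcQ])
    obtain ⟨g, hg⟩ := MulAction.exists_smul_eq G Q P
    rw [← hg, Sylow.coe_subgroup_smul, ← hQx]
    rintro _ ⟨y, hy, rfl⟩
    obtain ⟨i, rfl⟩ := mem_zpowers_iff.1 hy
    exact hNn.conj_mem _ (N.zpow_mem x.2 i) g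
  have hsup : normalizer (P : Set G) ⊔ N = ⊤ := P.normalizer_sup_eq_top' hPN
  have hidx : N.index ∣ 55 := by
    have h2 : N.index = N.relIndex (normalizer (P : Set G)) := by
      rw [← relIndex_top_right, ← hsup, relIndex_sup_right]
    rw [h2, ← hN]
    exact Subgroup.relIndex_dvd_card _ _
  have hcm := N.card_mul_index
  rw [hG] at hcm
  have hi1 : N.index ≠ 1 := fun h => htop (Subgroup.index_eq_one.1 h)
  have hcard : Nat.card N = 1584 ∧ N.index = 5 := by
    obtain ⟨k, hk⟩ := hd
    have : N.index ≤ 55 := Nat.le_of_dvd (by norm_num) hidx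
    generalize N.index = j at *
    obtain ⟨k', hk'⟩ := hidx
    have : j = 5 := by
      rw [hk] at hcm
      have : j * k = 720 := by nlinarith
      interval_cases j <;> omega
    subst this; omega
  -- Sylow subgroup of N
  let Q : Sylow 11 N := P.subtype hPN
  have hQc : Nat.card Q = 11 := by
    have : (Q : Subgroup N) = (P : Subgroup G).subgroupOf N := P.coe_subtype hPN
    change Nat.card (Q : Subgroup N) = 11
    rw [this, Nat.card_congr (subgroupOfEquivOfLe hPN).toEquiv]; exact hP
  have hnQ : Nat.card (normalizer (Q : Set N)) = 11 := by
    have h1 : (normalizer (Q : Set N)).map N.subtype ≤ normalizer (P : Set G) ⊓ N := by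
      rintro _ ⟨x, hx, rfl⟩
      refine ⟨?_, x.2⟩
      have hx' : x ∈ normalizer (Q : Set N) := hx
      change (x : G) ∈ normalizer ((P : Subgroup G) : Set G)
      rw [mem_normalizer_iff]
      intro h
      replace hx' := mem_normalizer_iff.1 (show x ∈ normalizer ((Q : Subgroup N) : Set N) from hx')
      have hQP : ∀ y : N, y ∈ Q ↔ (y : G) ∈ P := fun y => Iff.rfl
      constructor
      · intro hh
        exact (hQP _).1 ((hx' ⟨h, hPN hh⟩).1 hh)
      · intro hh
        have h3 : (x : G) * h * (x : G)⁻¹ ∈ N := hPN hh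
        have h4 : h ∈ N := by
          have := N.mul_mem (N.mul_mem (N.inv_mem x.2) h3) x.2
          simpa [mul_assoc] using this
        exact (hQP _).1 ((hx' ⟨h, h4⟩).2 hh)
    have h2 : Nat.card (normalizer (Q : Set N)) ∣ 55 := by
      rw [← hN, Nat.card_congr ((normalizer (Q : Set N)).equivMapOfInjective N.subtype N.subtype_injective).toEquiv]
      exact Subgroup.card_dvd_of_le (h1.trans inf_le_left)
    have h3 : Nat.card (normalizer (Q : Set N)) ∣ 1584 := by
      rw [← hcard.1]; exact Subgroup.card_subgroup_dvd_card _
    have h4 : 11 ∣ Nat.card (normalizer (Q : Set N)) := by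
      have := Subgroup.card_dvd_of_le (le_normalizer (H := (Q : Subgroup N)))
      rwa [show Nat.card (Q : Subgroup N) = 11 from hQc] at this
    have h5 := Nat.dvd_gcd h2 h3
    exact Nat.dvd_antisymm h5 h4
  have hQn : (Q : Subgroup N) = normalizer (Q : Set N) := Subgroup.eq_of_le_of_card_ge le_normalizer (by
      rw [hnQ]; exact hQc.ge)
  have hQ : normalizer (Q : Set N) ≤ centralizer (Q : Set N) := by
    rw [← hQn]
    have : IsCyclic Q := isCyclic_of_prime_card (p := 11) hQc
    intro x hx
    rw [mem_centralizer_iff]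
    intro y hy
    have := IsCyclic.isMulCommutative (α := Q)
    exact congrArg Subtype.val (this.is_comm.comm (⟨y, hy⟩ : Q) ⟨x, hx⟩)
  have hcomp := MonoidHom.ker_transferSylow_isComplement' Q hQ
  set φ := MonoidHom.transferSylow Q hQ with hφ
  have hkc : Nat.card φ.ker = 144 := by
    have := hcomp.card_mul_card
    rw [show Nat.card (Q : Subgroup N) = 11 from hQc, hcard.1] at this; omega
  have hnorm : (φ.ker.map N.subtype).Normal := by
    constructor
    rintro _ ⟨x, hx, rfl⟩ g
    refine ⟨⟨g * x * g⁻¹, hNn.conj_mem _ x.2 g⟩, ?_, rfl⟩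
    have hx' : x ∈ φ.ker := hx
    change _ ∈ φ.ker
    rw [MonoidHom.mem_ker]
    have hp : x ^ 144 = 1 := by
      have := pow_card_eq_one' (G := φ.ker) (x := ⟨x, hx'⟩)
      rw [hkc] at this
      exact congrArg Subtype.val this
    set y : N := ⟨g * x * g⁻¹, hNn.conj_mem _ x.2 g⟩
    have hy : y ^ 144 = 1 := by
      apply Subtype.ext
      change (g * x * g⁻¹) ^ 144 = 1
      rw [conj_pow]
      have : (x : G) ^ 144 = 1 := congrArg Subtype.val hp
      rw [this]; simp
    have h1 : φ y ^ 144 = 1 := by rw [← map_pow, hy, map_one]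
    have h2 : φ y ^ 11 = 1 := by
      have := pow_card_eq_one' (G := Q) (x := φ y)
      rwa [hQc] at this
    have h3 := orderOf_dvd_of_pow_eq_one h1
    have h4 := orderOf_dvd_of_pow_eq_one h2
    exact orderOf_eq_one_iff.1 (Nat.dvd_one.1 (Nat.dvd_gcd h3 h4))
  have hc : Nat.card (φ.ker.map N.subtype) = 144 := by
    rw [← Nat.card_congr (φ.ker.equivMapOfInjective N.subtype N.subtype_injective).toEquiv, hkc]
  have := h11 _ hnorm (by
    intro h; rw [h] at hc; simp at hc)
  rw [hc] at this
  revert this; decide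
end M11

namespace M11
open Equiv

theorem col_compl : ∀ (t : Fin 12) (j : Fin 11), (2047 - col t).testBit j = !(col t).testBit j ∧
    mem j 0 = false ∧ (2047).testBit j = true := by decide +kernel

theorem cand_map (τ : Perm (Fin 12)) (j j' : Fin 11) (h : ∀ i, mem j i = mem j' (τ i)) (l : List (Fin 12)) :
    (cand j l (l.map τ)).testBit j' = true := by
  induction l with
  | nil => exact (col_compl 0 j').2.2
  | cons a l ih =>
    simp only [List.map_cons, cand, Nat.testBit_and, ih, Bool.and_true]
    have := h a
    split_ifs with h1
    · rw [h1] at this; exact this.symm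
    · rw [(col_compl _ _).1]
      change (!(mem j' (τ a))) = true
      rw [← this]; simpa using h1

theorem okL_map (τ : Perm (Fin 12)) (h : Pres τ) (h0 : τ 0 = 0) (k : ℕ) : okL k ((pts k).map τ) = true := by
  simp only [okL, List.all_eq_true, List.mem_finRange, true_imp_iff]
  intro j
  obtain ⟨j', hj'⟩ := h j
  have h1 : ∀ i, mem j i = mem j' (τ i) := by
    intro i
    have := hj' 0 i
    simp only [R, h0, (col_compl 0 _).2.1] at this
    simpa using this
  have h2 := cand_map τ j j' h1 (pts k)
  by_contra hcon
  have h3 : cand j (pts k) ((pts k).map τ) = 0 := by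
    apply Nat.eq_of_beq_eq_true
    simpa using hcon
  rw [h3] at h2
  simp at h2

theorem pts_succ : ∀ k : Fin 10, ∃ x, pts ((k : ℕ) + 3) = pts (k + 2) ++ [x] ∧ x ∉ pts (k + 2) := by decide +kernel

theorem lev_map (τ : Perm (Fin 12)) (h : Pres τ) (h0 : τ 0 = 0) (h1 : τ 1 = 1) (k : ℕ) (hk : k ≤ 10) :
    (pts (k + 2)).map τ ∈ lev k := by
  induction k with
  | zero =>
    have : pts 2 = [0, 1] := by decide +kernel
    simp [this, lev, h0, h1]
  | succ k ih =>
    obtain ⟨x, hx, hx'⟩ := pts_succ ⟨k, by omega⟩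
    simp only [lev, extL]
    rw [List.mem_filter]
    refine ⟨?_, okL_map τ h h0 _⟩
    rw [List.mem_flatMap]
    refine ⟨_, ih (by omega), ?_⟩
    rw [List.mem_map]
    refine ⟨τ x, ?_, ?_⟩
    · simp only [List.mem_filter, List.mem_finRange, true_and]
      simpa using hx'
    · simp only [show k + 1 + 2 = k + 3 from rfl]
      simp only at hx
      rw [hx]; simp

theorem pts12 : pts 12 = List.finRange 12 := by decide +kernel

theorem stab_le {G : Type*} [Group G] [Finite G] (ρ : G →* Perm (Fin 12)) (hinj : Function.Injective ρ)
    (hpres : ∀ g, Pres (ρ g)) (H : Subgroup G) (h0 : ∀ g ∈ H, ρ g 0 = 0) (h1 : ∀ g ∈ H, ρ g 1 = 1) :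
    Nat.card H ≤ 60 := by
  let φ : H → (lev 10).toFinset := fun g =>
    ⟨(pts 12).map (ρ g), List.mem_toFinset.2 (lev_map _ (hpres _) (h0 _ g.2) (h1 _ g.2) 10 le_rfl)⟩
  have hφ : Function.Injective φ := by
    intro a b hab
    have h2 : (pts 12).map (ρ a) = (pts 12).map (ρ b) := congrArg Subtype.val hab
    rw [pts12] at h2
    apply Subtype.ext
    apply hinj
    ext i
    rw [List.map_inj_left.1 h2 i (List.mem_finRange i)]
  calc Nat.card H ≤ Nat.card (lev 10).toFinset := Nat.card_le_card_of_injective φ hφ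
    _ = (lev 10).toFinset.card := by rw [Nat.card_eq_fintype_card, Fintype.card_coe]
    _ ≤ (lev 10).length := List.toFinset_card_le _
    _ = 60 := lev10

/-- a permutation preserving every relation is trivial -/
theorem pres_trivial (τ : Perm (Fin 12)) (h : ∀ j i i', R j i i' = R j (τ i) (τ i')) : τ = 1 := by
  obtain ⟨hA, hB⟩ := pres_col
  have h0 : τ 0 = 0 := by
    by_contra hne
    obtain ⟨i, hi⟩ := hA _ hne
    obtain ⟨j, hj⟩ := hi (τ i)
    exact hj (h j i 0)
  ext i
  rw [hB i (τ i) (fun j => by rw [h j i 0, h0])]; rfl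

theorem exists_hom11 {G : Type*} [Group G] (ρ : G →* Perm (Fin 12)) (hinj : Function.Injective ρ)
    (hpres : ∀ g, Pres (ρ g)) : ∃ ψ : G →* Perm (Fin 11), Function.Injective ψ := by
  choose f hf using hpres
  have huniq : ∀ g j k, (∀ i i', R j i i' = R k (ρ g i) (ρ g i')) → k = f g j := by
    intro g j k hk
    apply row_uniq
    intro i i'
    have h1 := hk ((ρ g).symm i) ((ρ g).symm i')
    have h2 := hf g j ((ρ g).symm i) ((ρ g).symm i')
    simp only [Equiv.apply_symm_apply] at h1 h2
    rw [← h1, h2]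
  let φ : G →* Function.End (Fin 11) :=
    { toFun := f
      map_one' := by
        funext j
        exact (huniq 1 j j (by simp)).symm
      map_mul' := by
        intro a b
        funext j
        refine (huniq (a * b) j (f a (f b j)) ?_).symm
        intro i i'
        rw [hf b j, hf a (f b j)]; simp }
  refine ⟨φ.toHomPerm, ?_⟩
  rw [injective_iff_map_eq_one]
  intro a ha
  have h1 : ∀ j, f a j = j := fun j => congrArg (fun p : Perm (Fin 11) => p j) ha
  apply hinj
  rw [map_one]
  apply pres_trivial
  intro j i i'
  rw [hf a j, h1 j]

theorem normal11 {G : Type*} [Group G] [Finite G] (ψ : G →* Perm (Fin 11)) (hψ : Function.Injective ψ)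
    (c : G) (hc : orderOf c = 11) (N : Subgroup G) (hN : N.Normal) (hb : N ≠ ⊥) : 11 ∣ Nat.card N := by
  let _ := MulAction.compHom (Fin 11) ψ
  have hsm : ∀ (g : G) x, g • x = ψ g x := fun _ _ => rfl
  have hoc : orderOf (ψ c) = 11 := by rw [orderOf_injective ψ hψ, hc]
  have hcyc : (ψ c).IsCycle := Equiv.Perm.isCycle_of_prime_order' (by rw [hoc]; norm_num) (by rw [hoc]; simp)
  have hsupp : (ψ c).support = Finset.univ := by
    rw [← Finset.card_eq_iff_eq_univ, ← hcyc.orderOf, hoc]; simp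
  have hmem : ∀ x, ψ c x ≠ x := fun x => Equiv.Perm.mem_support.1 (by rw [hsupp]; simp)
  have : MulAction.IsPretransitive G (Fin 11) := by
    constructor
    intro x y
    obtain ⟨i, hi⟩ := hcyc.exists_zpow_eq (hmem x) (hmem y)
    exact ⟨c ^ i, by rw [hsm, map_zpow, hi]⟩
  have hprim : MulAction.IsPreprimitive G (Fin 11) := MulAction.IsPreprimitive.of_prime_card (by simp; norm_num)
  have hq : MulAction.IsPretransitive N (Fin 11) := by
    apply MulAction.IsQuasiPreprimitive.isPretransitive_of_normal (G := G)
    intro h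
    apply hb
    rw [eq_bot_iff]
    intro x hx
    apply hψ
    rw [map_one]
    ext i
    have : i ∈ MulAction.fixedPoints N (Fin 11) := by rw [h]; trivial
    have := this ⟨x, hx⟩
    exact congrArg Fin.val this
  have h1 := MulAction.index_stabilizer_of_transitive N (0 : Fin 11)
  rw [Nat.card_eq_fintype_card, Fintype.card_fin] at h1
  rw [← h1]
  exact Subgroup.index_dvd_card _

theorem aux30 (N m k : ℕ) (h1 : N = 132 * m) (h2 : N = 132 * k) (h3 : 3 ∣ k) (h5 : 5 ∣ N) (h8 : 8 ∣ N) :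
    30 ∣ m := by
  have hk : k = m := by rw [h1] at h2; exact (Nat.eq_of_mul_eq_mul_left (by norm_num) h2).symm
  subst hk
  rw [h1] at h5 h8
  have h5' : 5 ∣ k := Nat.Coprime.dvd_of_dvd_mul_left (by norm_num) h5
  have h8' : 2 ∣ k := by
    have : 4 * 2 ∣ 4 * (33 * k) := by rw [← mul_assoc]; exact h8
    exact Nat.Coprime.dvd_of_dvd_mul_left (m := 33) (by norm_num) (Nat.dvd_of_mul_dvd_mul_left (by norm_num) this)
  have h6 : 2 * 3 ∣ k := Nat.Coprime.mul_dvd_of_dvd_of_dvd (by norm_num) h8' h3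
  exact Nat.Coprime.mul_dvd_of_dvd_of_dvd (m := 6) (n := 5) (by norm_num) h6 h5'

theorem gt {G : Type*} [Group G] [Finite G] (ρ : G →* Perm (Fin 12)) (hinj : Function.Injective ρ)
    (hpres : ∀ g, Pres (ρ g)) (c e t u : G) (hc : orderOf c = 11) (he : orderOf e = 8)
    (ht : orderOf t = 5) (hu : orderOf u = 3) (hefix : ∀ i, ρ e i ≠ i)
    (a b : Fin 12) (hab : a ≠ b) (hua : ρ u a = a) (hub : ρ u b = b) :
    Nat.card G = 7920 ∧ IsSimpleGroup G ∧ ∀ x y, ∃ g, ρ g x = y := by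
  have hoc : orderOf (ρ c) = 11 := by rw [orderOf_injective ρ hinj, hc]
  have hcyc : (ρ c).IsCycle := Equiv.Perm.isCycle_of_prime_order' (by rw [hoc]; norm_num) (by rw [hoc]; simp)
  have hsupp : (ρ c).support.card = 11 := by rw [← hcyc.orderOf, hoc]
  obtain ⟨z, hz⟩ : ∃ z, (ρ c).supportᶜ = {z} := by
    rw [← Finset.card_eq_one, Finset.card_compl, hsupp]; rfl
  have hz1 : ∀ x, ρ c x = x ↔ x = z := by
    intro x
    rw [← Equiv.Perm.notMem_support, ← Finset.mem_compl, hz, Finset.mem_singleton]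
  have hcz : ρ c z = z := (hz1 z).2 rfl
  have hcyc2 : ∀ x y, x ≠ z → y ≠ z → ∃ i : ℤ, ρ (c ^ i) x = y := by
    intro x y hx hy
    obtain ⟨i, hi⟩ := hcyc.exists_zpow_eq (x := x) (y := y) (mt (hz1 x).1 hx) (mt (hz1 y).1 hy)
    exact ⟨i, by rw [map_zpow, hi]⟩
  have hpz : ∀ i : ℤ, ρ (c ^ i) z = z := by
    intro i
    rw [map_zpow]
    exact Equiv.Perm.zpow_apply_eq_self_of_apply_eq_self hcz i
  obtain ⟨w, hw⟩ : ∃ w, w = ρ e z := ⟨_, rfl⟩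
  have hwz : w ≠ z := hw ▸ hefix z
  have htr : ∀ y, ∃ g, ρ g z = y := by
    intro y
    by_cases hy : y = z
    · exact ⟨1, by simp [hy]⟩
    · obtain ⟨i, hi⟩ := hcyc2 w y hwz hy
      exact ⟨c ^ i * e, by rw [map_mul, Equiv.Perm.mul_apply, ← hw, hi]⟩
  have htr2 : ∀ x y, x ≠ y → ∃ g, ρ g z = x ∧ ρ g w = y := by
    intro x y hxy
    obtain ⟨h, hh⟩ := htr x
    have : (ρ h).symm y ≠ z := by
      intro h2
      rw [Equiv.symm_apply_eq, hh] at h2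
      exact hxy h2.symm
    obtain ⟨i, hi⟩ := hcyc2 w _ hwz this
    refine ⟨h * c ^ i, ?_, ?_⟩
    · rw [map_mul, Equiv.Perm.mul_apply, hpz, hh]
    · rw [map_mul, Equiv.Perm.mul_apply, hi, Equiv.apply_symm_apply]
  let _ := MulAction.compHom (Fin 12) ρ
  have hsm : ∀ (g : G) (x : Fin 12), g • x = ρ g x := fun _ _ => rfl
  have hst : ∀ x y : Fin 12, x ≠ y → Nat.card G = 132 * Nat.card (MulAction.stabilizer G (x, y)) := by
    intro x y hxy
    have h1 : MulAction.orbit G (x, y) = ((Finset.univ.filter fun p : Fin 12 × Fin 12 => p.1 ≠ p.2 : Finset _) : Set _) := by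
      ext ⟨p, q⟩
      simp only [Finset.coe_filter, Finset.mem_univ, true_and, Set.mem_ofPred_eq]
      constructor
      · rintro ⟨g, hg⟩
        have h1 : ρ g x = p := congrArg Prod.fst hg
        have h2 : ρ g y = q := congrArg Prod.snd hg
        rw [← h1, ← h2]
        exact fun h => hxy ((ρ g).injective h)
      · intro hpq
        obtain ⟨g, hg1, hg2⟩ := htr2 x y hxy
        obtain ⟨h, hh1, hh2⟩ := htr2 p q hpq
        refine ⟨h * g⁻¹, ?_⟩
        apply Prod.ext
        · change ρ (h * g⁻¹) x = p
          rw [← hg1, ← hh1]; simp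
        · change ρ (h * g⁻¹) y = q
          rw [← hg2, ← hh2]; simp
    have h2 := MulAction.index_stabilizer G (x, y)
    rw [h1, Set.ncard_coe_finset] at h2
    have h3 : (Finset.univ.filter fun p : Fin 12 × Fin 12 => p.1 ≠ p.2).card = 132 := by decide +kernel
    rw [h3] at h2
    rw [← Subgroup.card_mul_index (MulAction.stabilizer G (x, y)), h2, mul_comm]
  have hm := hst 0 1 (by decide)
  have hst3 : 3 ∣ Nat.card (MulAction.stabilizer G (a, b)) := by
    have hmem : u ∈ MulAction.stabilizer G (a, b) := Prod.ext hua hub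
    have := orderOf_dvd_natCard (⟨u, hmem⟩ : MulAction.stabilizer G (a, b))
    rwa [Subgroup.orderOf_mk, hu] at this
  have hle := stab_le ρ hinj hpres (MulAction.stabilizer G ((0 : Fin 12), (1 : Fin 12)))
    (fun g hg => congrArg Prod.fst hg) (fun g hg => congrArg Prod.snd hg)
  have h3 := hst a b hab
  have h5 : 5 ∣ Nat.card G := ht ▸ orderOf_dvd_natCard t
  have h8 : 8 ∣ Nat.card G := he ▸ orderOf_dvd_natCard e
  have hcent : ∀ g, Commute g c → g ∈ Subgroup.zpowers c := by
    intro g hg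
    have hg' : Commute (ρ g) (ρ c) := hg.map ρ
    have hgz : ρ g z = z := by
      rw [← hz1, ← Equiv.Perm.mul_apply, ← hg'.eq, Equiv.Perm.mul_apply, hcz]
    obtain ⟨i, hi⟩ := hcyc2 w (ρ g w) hwz (by
      intro h; rw [← hgz] at h; exact hwz ((ρ g).injective h))
    rw [Subgroup.mem_zpowers_iff]
    refine ⟨i, hinj ?_⟩
    ext x
    congr 1
    by_cases hx : x = z
    · rw [hx, hpz, hgz]
    · obtain ⟨k, rfl⟩ := hcyc2 w x hwz hx
      rw [← Equiv.Perm.mul_apply, ← Equiv.Perm.mul_apply, ← map_mul, ← map_mul, (hg.zpow_right k).eq, ← zpow_add, add_comm, zpow_add, map_mul, map_mul,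
        Equiv.Perm.mul_apply, Equiv.Perm.mul_apply, hi]
  obtain ⟨h7920, P, hP, hN⟩ := sylow11 c hc hcent _ hm (aux30 _ _ _ hm h3 hst3 h5 h8) hle
  obtain ⟨ψ, hψ⟩ := exists_hom11 ρ hinj hpres
  refine ⟨h7920, simple7920 h7920 P hP hN (fun N h1 h2 => normal11 ψ hψ c hc N h1 h2), ?_⟩
  intro x y
  obtain ⟨g, rfl⟩ := htr x
  obtain ⟨h, rfl⟩ := htr y
  exact ⟨h * g⁻¹, by simp⟩
end M11

namespace M11
open Polynomial NumberField

section frob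
variable (M : Type) [Field M] [NumberField M] [IsGalois ℚ M]

theorem invariant_int : Algebra.IsInvariant ℤ (𝓞 M) (M ≃ₐ[ℚ] M) := by
  constructor
  intro b hb
  have h1 : ∀ g : M ≃ₐ[ℚ] M, g (b : M) = b := fun g => congrArg (fun x : 𝓞 M => (x : M)) (hb g)
  obtain ⟨q, hq⟩ := (IsGalois.mem_range_algebraMap_iff_fixed (b : M)).2 h1
  have h2 : IsIntegral ℤ q := by
    have := b.isIntegral_coe
    rw [show algebraMap (𝓞 M) M b = algebraMap ℚ M q from hq.symm] at this
    exact (isIntegral_algebraMap_iff (algebraMap ℚ M).injective).1 this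
  obtain ⟨z, hz⟩ := IsIntegrallyClosed.isIntegral_iff.1 h2
  refine ⟨z, ?_⟩
  apply RingOfIntegers.ext
  rw [← hq, ← hz]; simp

theorem exists_frob (ℓ : ℕ) (hℓ : ℓ.Prime) :
    ∃ (k : Type) (_ : Field k) (φ : 𝓞 M →+* k) (σ : M ≃ₐ[ℚ] M), (ℓ : k) = 0 ∧
      ∀ x : 𝓞 M, φ (σ • x) = φ x ^ ℓ := by
  have hmax : (Ideal.span {(ℓ : ℤ)}).IsMaximal :=
    PrincipalIdealRing.isMaximal_of_irreducible (Nat.prime_iff_prime_int.1 hℓ).irreducible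
  obtain ⟨Q, hQ, hover⟩ := Ideal.exists_maximal_ideal_liesOver_of_isIntegral (Ideal.span {(ℓ : ℤ)}) (S := 𝓞 M)
  have hunder : Q.under ℤ = Ideal.span {(ℓ : ℤ)} := hover.over.symm
  have hmem : (ℓ : 𝓞 M) ∈ Q := by
    have : (ℓ : ℤ) ∈ Q.under ℤ := by rw [hunder]; exact Ideal.mem_span_singleton_self _
    simpa using Ideal.mem_comap.1 this
  have hQ0 : Q ≠ ⊥ := by
    rintro rfl
    rw [Ideal.mem_bot] at hmem
    exact hℓ.ne_zero (by exact_mod_cast hmem)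
  have := hQ.isPrime
  have : Finite (𝓞 M ⧸ Q) := Ring.HasFiniteQuotients.finiteQuotient hQ0
  have := invariant_int M
  obtain ⟨σ, hσ⟩ := IsArithFrobAt.exists_of_isInvariant ℤ (M ≃ₐ[ℚ] M) Q
  have hcard : Nat.card (ℤ ⧸ Q.under ℤ) = ℓ := by
    rw [hunder, Nat.card_congr (Int.quotientSpanNatEquivZMod ℓ).toEquiv, Nat.card_zmod]
  refine ⟨𝓞 M ⧸ Q, Ideal.Quotient.field Q, Ideal.Quotient.mk Q, σ, ?_, ?_⟩
  · have := Ideal.Quotient.eq_zero_iff_mem.2 hmem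
    simpa using this
  · intro x
    have := AlgHom.IsArithFrobAt.mk_apply hσ x
    rw [hcard] at this
    exact this
end frob

theorem exists_map_eq {A B : Type*} (f : A → B) (t : Multiset B) (h : ∀ x ∈ t, ∃ y, f y = x) :
    ∃ s : Multiset A, s.map f = t := by
  induction t using Multiset.induction_on with
  | empty => exact ⟨0, rfl⟩
  | cons a t ih =>
    obtain ⟨s, hs⟩ := ih (fun x hx => h x (Multiset.mem_cons_of_mem hx))
    obtain ⟨y, hy⟩ := h a (Multiset.mem_cons_self a t)
    exact ⟨y ::ₘ s, by simp [hs, hy]⟩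

theorem toP_monic (R : Type*) [CommRing R] [Nontrivial R] (l : List ℤ) :
    (toP R (l ++ [1])).Monic ∧ (toP R (l ++ [1])).natDegree = l.length := by
  induction l with
  | nil => simp [toP]
  | cons a l ih =>
    have h : toP R (a :: l ++ [1]) = X * toP R (l ++ [1]) + C (a : R) := by
      simp [toP]; ring
    have h1 : (X * toP R (l ++ [1])).Monic := monic_X.mul ih.1
    have h2 : (X * toP R (l ++ [1])).natDegree = l.length + 1 := by
      rw [monic_X.natDegree_mul ih.1, ih.2, natDegree_X, add_comm]
    rw [h]
    constructor
    · apply h1.add_of_left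
      refine lt_of_le_of_lt degree_C_le ?_
      rw [← natDegree_pos_iff_degree_pos, h2]; omega
    · rw [natDegree_add_C, h2]; rfl

theorem lift_split (M : Type) [Field M] [NumberField M] (l : List ℤ)
    (hs : (toP M (l ++ [1])).Splits) :
    ∃ s : Multiset (𝓞 M), toP (𝓞 M) (l ++ [1]) = (s.map fun a => X - C a).prod := by
  have hmon := (toP_monic M l).1
  obtain ⟨s, hs'⟩ := exists_map_eq (algebraMap (𝓞 M) M) (toP M (l ++ [1])).roots (by
    intro x hx
    have hx' : ev x (l ++ [1]) = 0 := by
      rw [← eval_toP]; exact (mem_roots'.1 hx).2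
    have : IsIntegral ℤ x := ⟨toP ℤ (l ++ [1]), (toP_monic ℤ l).1, by
      rw [← aeval_def, aeval_toP, hx']⟩
    exact ⟨⟨x, this⟩, rfl⟩)
  refine ⟨s, ?_⟩
  apply Polynomial.map_injective (algebraMap (𝓞 M) M) RingOfIntegers.coe_injective
  rw [map_toP, hs.eq_prod_roots_of_monic hmon, ← hs', Polynomial.map_multiset_prod]
  simp [Multiset.map_map, Function.comp_def]
end M11

namespace M11
open Polynomial NumberField

/-- coefficients of the degree 12 polynomial (without the leading one), scaled by 4 -/
def Fl : List ℤ := [1048576,5505024,4521984,-3440640,1413120,-685056,187136,-15744,-1680,-60,159,-24]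

def negM (p : ℤ) (l : List ℤ) : List ℤ := l.map fun a => (-a) % p

/-- `l ^ e mod (F, p)` with the exponent given by its bits -/
def powB (p : ℤ) (rel : List ℤ) : List Bool → List ℤ → List ℤ
  | [], _ => [1]
  | b :: bs, l =>
    let s := powB p rel bs l
    let t := modL p (mulM 12 rel s s)
    if b then modL p (mulM 12 rel t l) else t

def bval : List Bool → ℕ
  | [] => 0
  | b :: bs => 2 * bval bs + b.toNat

def b13 : List Bool := [true, false, true, true]
def b19 : List Bool := [true, true, false, false, true]
def b31 : List Bool := [true, true, true, true, true]
def b137 : List Bool := [true, false, false, true, false, false, false, true]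

def frobs (p : ℤ) (bs : List Bool) : ℕ → List ℤ
  | 0 => [0, 1]
  | d + 1 => powB p (negM p Fl) bs (frobs p bs d)

theorem ev_append {R : Type*} [CommRing R] (y : R) (l m : List ℤ) :
    ev y (l ++ m) = ev y l + y ^ l.length * ev y m := by
  induction l with
  | nil => simp
  | cons a l ih => simp [ih]; ring

theorem pow12 {R : Type*} [CommRing R] (p : ℕ) (hp : (p : R) = 0) (y : R) (hy : ev y (Fl ++ [1]) = 0) :
    y ^ 12 = ev y (negM p Fl) := by
  have h1 : negM p Fl = modL p (smulL (-1) Fl) := by simp [negM, modL, smulL]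
  rw [h1, ev_modL y p hp, ev_smulL]
  rw [ev_append, show Fl.length = 12 from rfl] at hy
  simp only [ev_cons, ev_nil] at hy
  push_cast at hy ⊢
  linear_combination hy

theorem ev_powB {R : Type*} [CommRing R] (p : ℕ) (hp : (p : R) = 0) (y : R) (rel : List ℤ)
    (h : y ^ 12 = ev y rel) (bs : List Bool) (l : List ℤ) :
    ev y (powB p rel bs l) = ev y l ^ bval bs := by
  induction bs with
  | nil => simp [powB, bval]
  | cons b bs ih =>
    cases b <;> simp [powB, bval, ev_modL y p hp, ev_mulM y 12 rel _ _ h, ih] <;> ring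

theorem ev_frobs {R : Type*} [CommRing R] (p : ℕ) (hp : (p : R) = 0) (y : R) (hy : ev y (Fl ++ [1]) = 0)
    (bs : List Bool) (d : ℕ) :
    ev y (frobs p bs d) = y ^ (bval bs ^ d) := by
  induction d with
  | zero => simp [frobs]
  | succ d ih => rw [frobs, ev_powB p hp y _ (pow12 p hp y hy), ih, ← pow_mul, pow_succ]

theorem cast_ne {k : Type*} [Field k] (p : ℕ) (hp : p.Prime) (hpk : (p : k) = 0) (n : ℤ)
    (hn : n % p ≠ 0) : (n : k) ≠ 0 := by
  have h1 : IsCoprime (p : ℤ) n := by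
    rw [(Nat.prime_iff_prime_int.1 hp).irreducible.coprime_iff_not_dvd]
    exact fun h => hn (Int.emod_eq_zero_of_dvd h)
  obtain ⟨u, v, huv⟩ := h1
  intro h
  have := congrArg (Int.cast : ℤ → k) huv
  push_cast at this
  rw [hpk, h] at this
  simp at this

theorem coeff_toP {k : Type*} [CommRing k] (l : List ℤ) (j : ℕ) :
    (toP k l).coeff j = ((l.getD j 0 : ℤ) : k) := by
  induction l generalizing j with
  | nil => simp [toP]
  | cons a l ih =>
    have h : toP k (a :: l) = C (a : k) + X * toP k l := by simp [toP]
    rw [h]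
    cases j with
    | zero => simp
    | succ j => rw [coeff_add, coeff_C_succ, coeff_X_mul, ih]; simp

theorem zero_of_roots {k : Type*} [Field k] {n : ℕ} (x : Fin n → k) (hx : Function.Injective x)
    (l : List ℤ) (hl : l.length ≤ n) (h : ∀ i, ev (x i) l = 0) (j : ℕ) :
    ((l.getD j 0 : ℤ) : k) = 0 := by
  rw [← coeff_toP]
  have h0 : toP k l = 0 := by
    by_cases hn : n = 0
    · have : l = [] := List.length_eq_zero_iff.1 (by omega)
      rw [this]; rfl
    apply Polynomial.eq_zero_of_natDegree_lt_card_of_eval_eq_zero (toP k l) hx (fun i => by rw [eval_toP, h])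
    have : (toP k l).natDegree ≤ n - 1 := by
      rw [natDegree_le_iff_coeff_eq_zero]
      intro N hN
      rw [coeff_toP, List.getD_eq_default _ _ (by omega)]; simp
    rw [Fintype.card_fin]; omega
  rw [h0]; simp

/-- product of the `x - r` -/
def prodL : List ℤ → List ℤ
  | [] => [1]
  | r :: l => mulL [-r, 1] (prodL l)

theorem ev_prodL {R : Type*} [CommRing R] (y : R) (l : List ℤ) :
    ev y (prodL l) = (l.map fun r : ℤ => y - (r : R)).prod := by
  induction l with
  | nil => simp [prodL]
  | cons a l ih => simp [prodL, ev_mulL, ih]; ring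

/-- labelling of the roots through a totally split prime -/
theorem label {O k : Type*} [CommRing O] [IsDomain O] [Field k] (φ : O →+* k) (p : ℕ) (hp : p.Prime)
    (hpk : (p : k) = 0) (L : List ℤ) (s : Multiset O) (hs : toP O L = (s.map fun a => X - C a).prod)
    {n : ℕ} (r : Fin n → ℤ) (hr : modL p (prodL (List.ofFn r)) = modL p L)
    (hd : ∀ i j, i ≠ j → (r i - r j) % p ≠ 0) :
    ∃ b : Fin n → O, (∀ i, φ (b i) = r i) ∧ (∀ i, ev (b i) L = 0) ∧ (∀ x, ev x L = 0 → ∃ i, x = b i) ∧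
      Function.Injective b ∧ toP O L = ∏ i, (X - C (b i)) := by
  have hpX : (p : k[X]) = 0 := by
    have := congrArg (C : k → k[X]) hpk
    simpa using this
  have h1 : toP k L = ((List.ofFn r).map fun x : ℤ => (X : k[X]) - C (x : k)).prod := by
    rw [toP, ← ev_modL X p hpX, ← hr, ev_modL X p hpX, ev_prodL]
    simp
  have h2 : toP k L = ((s.map φ).map fun a => X - C a).prod := by
    rw [← map_toP φ, hs, Polynomial.map_multiset_prod]
    simp [Multiset.map_map]
  have h3 : s.map φ = Multiset.map (fun i => ((r i : ℤ) : k)) Finset.univ.val := by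
    have e1 := congrArg Polynomial.roots h1
    rw [h2, roots_multiset_prod_X_sub_C] at e1
    rw [e1, ← Multiset.prod_coe, ← Multiset.map_coe]
    have : (fun x : ℤ => (X : k[X]) - C (x : k)) = (fun a => X - C a) ∘ (Int.cast : ℤ → k) := rfl
    rw [this, ← Multiset.map_map, roots_multiset_prod_X_sub_C, Multiset.map_coe, List.map_ofFn, Fin.univ_val_map]
    rfl
  have hinj : Function.Injective fun i => ((r i : ℤ) : k) := by
    intro i j hij
    by_contra hne
    apply cast_ne p hp hpk _ (hd i j hne)
    push_cast
    exact sub_eq_zero.2 hij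
  have hnd : (s.map φ).Nodup := by
    rw [h3]; exact Finset.univ.nodup.map hinj
  have hroot : ∀ x, ev x L = 0 ↔ x ∈ s := by
    intro x
    rw [← eval_toP, hs, eval_multiset_prod, Multiset.map_map, Multiset.prod_eq_zero_iff, Multiset.mem_map]
    constructor
    · rintro ⟨a, ha, h⟩
      have : x = a := by simpa [sub_eq_zero] using h
      rwa [this]
    · intro h; exact ⟨x, h, by simp⟩
  have hex : ∀ i, ∃ x ∈ s, φ x = r i := by
    intro i
    rw [← Multiset.mem_map, h3, Multiset.mem_map]
    exact ⟨i, Finset.mem_univ_val i, rfl⟩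
  choose b hbs hbr using hex
  have hb : Function.Injective b := by
    intro i j hij
    apply hinj
    change ((r i : ℤ) : k) = r j
    rw [← hbr, ← hbr, hij]
  have hall : ∀ x, ev x L = 0 → ∃ i, x = b i := by
    intro x hx
    rw [hroot] at hx
    have : φ x ∈ s.map φ := Multiset.mem_map_of_mem φ hx
    rw [h3, Multiset.mem_map] at this
    obtain ⟨i, -, hi⟩ := this
    exact ⟨i, Multiset.inj_on_of_nodup_map hnd _ hx _ (hbs i) (by rw [hbr, hi])⟩
  refine ⟨b, hbr, fun i => (hroot _).2 (hbs i), hall, hb, ?_⟩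
  have : s = Multiset.map b Finset.univ.val := by
    rw [Multiset.Nodup.ext (Multiset.Nodup.of_map φ hnd) (Finset.univ.nodup.map hb)]
    intro x
    rw [← hroot, Multiset.mem_map]
    constructor
    · intro h
      obtain ⟨i, hi⟩ := hall x h
      exact ⟨i, Finset.mem_univ_val i, hi.symm⟩
    · rintro ⟨i, -, rfl⟩
      exact (hroot _).2 (hbs i)
  rw [hs, this, Multiset.map_map]; rfl

/-- reduction is injective on the roots if `x ^ (p ^ d) = x` modulo `F` -/
theorem red_inj {O k : Type*} [CommRing O] [IsDomain O] [Field k] (φ : O →+* k) (p : ℕ) (hp : p.Prime)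
    (hpk : (p : k) = 0) (b : Fin 12 → O) (hb : toP O (Fl ++ [1]) = ∏ i, (X - C (b i)))
    (bs : List Bool) (hbs : bval bs = p) (d : ℕ) (hd : d ≠ 0)
    (hf : frobs p bs d = [0, 1, 0, 0, 0, 0, 0, 0, 0, 0, 0, 0]) : Function.Injective fun i => φ (b i) := by
  have h1 : toP k (Fl ++ [1]) = ∏ i, (X - C (φ (b i))) := by
    rw [← map_toP φ, hb, Polynomial.map_prod]; simp
  have hch : CharP k p := (CharP.charP_iff_prime_eq_zero hp).2 hpk
  have hdvd : toP k (Fl ++ [1]) ∣ X ^ (p ^ d) - X := by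
    rw [← AdjoinRoot.mk_eq_zero]
    have hy : ev (AdjoinRoot.root (toP k (Fl ++ [1]))) (Fl ++ [1]) = 0 := by
      rw [← aeval_toP (R := k), AdjoinRoot.aeval_eq, AdjoinRoot.mk_self]
    have hpA : (p : AdjoinRoot (toP k (Fl ++ [1]))) = 0 := by
      rw [← map_natCast (algebraMap k (AdjoinRoot (toP k (Fl ++ [1])))), hpk, map_zero]
    have := ev_frobs p hpA _ hy bs d
    rw [hf, hbs] at this
    simp only [map_sub, map_pow, AdjoinRoot.mk_X]
    rw [← this]; simp
  have hsep : (toP k (Fl ++ [1])).Separable := (galois_poly_separable p (p ^ d) (dvd_pow_self p hd)).of_dvd hdvd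
  have hnd := nodup_roots hsep
  rw [h1] at hnd
  have h2 : (∏ i, (X - C (φ (b i)))).roots = Multiset.map (fun i => φ (b i)) Finset.univ.val := by
    have := roots_multiset_prod_X_sub_C (Multiset.map (fun i => φ (b i)) Finset.univ.val)
    rw [Multiset.map_map] at this
    exact this
  rw [h2] at hnd
  intro i j hij
  exact Multiset.inj_on_of_nodup_map hnd _ (Finset.mem_univ_val i) _ (Finset.mem_univ_val j) hij

end M11

namespace M11
open Polynomial NumberField

theorem exists_rho {G O : Type*} [Group G] [CommRing O] [MulSemiringAction G O] (L : List ℤ) {n : ℕ}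
    (b : Fin n → O) (hinj : Function.Injective b) (hroot : ∀ i, ev (b i) L = 0)
    (hall : ∀ x, ev x L = 0 → ∃ i, x = b i) :
    ∃ ρ : G →* Equiv.Perm (Fin n), ∀ g i, g • b i = b (ρ g i) := by
  have h : ∀ (g : G) i, ∃ j, g • b i = b j := by
    intro g i
    apply hall
    have := map_ev (MulSemiringAction.toRingHom G O g) (b i) L
    rw [hroot, map_zero] at this
    exact this.symm
  choose r hr using h
  have h1 : ∀ i, r 1 i = i := fun i => hinj (by rw [← hr, one_smul])
  have h2 : ∀ g h i, r (g * h) i = r g (r h i) := fun g h i => hinj (by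
    rw [← hr, ← hr, mul_smul, ← hr])
  refine ⟨MonoidHom.mk' (fun g => ⟨r g, r g⁻¹, fun i => by rw [← h2, inv_mul_cancel, h1],
    fun i => by rw [← h2, mul_inv_cancel, h1]⟩) ?_, ?_⟩
  · intro g h
    ext i
    simp [h2]
  · intro g i
    exact hr g i

section orders
set_option linter.unusedSectionVars false
variable {G O k : Type*} [Group G] [CommRing O] [IsDomain O] [MulSemiringAction G O] [Field k]
  (φ : O →+* k) (p : ℕ) (hp : p.Prime) (hpk : (p : k) = 0) (b : Fin 12 → O)
  (hb : toP O (Fl ++ [1]) = ∏ i, (X - C (b i))) (ρ : G →* Equiv.Perm (Fin 12))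
  (hρ : ∀ g i, g • b i = b (ρ g i)) (σ : G) (hσ : ∀ x, φ (σ • x) = φ x ^ p)
  (bs : List Bool) (hbs : bval bs = p)

include hb in
theorem root_b (i : Fin 12) : ev (b i) (Fl ++ [1]) = 0 := by
  rw [← eval_toP, hb, eval_prod]
  exact Finset.prod_eq_zero (Finset.mem_univ i) (by simp)

include hσ in
theorem frob_pow (e : ℕ) (x : O) : φ (σ ^ e • x) = φ x ^ (p ^ e) := by
  induction e with
  | zero => simp
  | succ e ih => rw [pow_succ', mul_smul, hσ, ih, ← pow_mul, pow_succ]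

include hb hpk hσ hbs in
theorem ev_red (e : ℕ) (i : Fin 12) : ev (φ (b i)) (frobs p bs e) = φ (σ ^ e • b i) := by
  rw [frob_pow φ p σ hσ, ev_frobs p hpk _ (by rw [← map_ev, root_b b hb, map_zero]), hbs]

include hp hpk hb hρ hσ hbs in
theorem rho_pow_one (d : ℕ) (hd : d ≠ 0) (hf : frobs p bs d = [0, 1, 0, 0, 0, 0, 0, 0, 0, 0, 0, 0]) :
    ρ σ ^ d = 1 := by
  ext i
  congr 1
  apply red_inj φ p hp hpk b hb bs hbs d hd hf
  change φ (b ((ρ σ ^ d) i)) = φ (b i)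
  rw [← map_pow, ← hρ, ← ev_red φ p hpk b hb σ hσ bs hbs, hf]
  simp

include hp hpk hb hρ hσ hbs in
theorem rho_pow_ne (d : ℕ) (hd : d ≠ 0) (hf : frobs p bs d = [0, 1, 0, 0, 0, 0, 0, 0, 0, 0, 0, 0])
    (e : ℕ) (he : (addL (frobs p bs e) [0, -1]).length ≤ 12 ∧
      (addL (frobs p bs e) [0, -1]).getD 0 0 % p ≠ 0) :
    ρ σ ^ e ≠ 1 := by
  intro h
  refine cast_ne p hp hpk _ he.2 (zero_of_roots (fun i => φ (b i))
    (red_inj φ p hp hpk b hb bs hbs d hd hf) _ he.1 ?_ 0)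
  intro i
  rw [ev_addL, ev_red φ p hpk b hb σ hσ bs hbs, hρ, map_pow, h]
  simp

include hpk hb hρ hσ hbs in
theorem rho_no_fix (u : List ℤ) (hu : modL p (mulM 12 (negM p Fl) (addL (frobs p bs 1) [0, -1]) u) =
    [1, 0, 0, 0, 0, 0, 0, 0, 0, 0, 0, 0]) (i : Fin 12) : ρ σ i ≠ i := by
  intro h
  have hr : ev (φ (b i)) (Fl ++ [1]) = 0 := by rw [← map_ev, root_b b hb, map_zero]
  have h1 := congrArg (ev (φ (b i))) hu
  rw [ev_modL _ p hpk, ev_mulM _ 12 _ _ _ (pow12 p hpk _ hr), ev_addL,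
    ev_red φ p hpk b hb σ hσ bs hbs, hρ, map_pow, pow_one, h] at h1
  simp at h1

include hp hpk hb hρ hσ in
theorem rho_fix (hinj : Function.Injective fun i => φ (b i)) (r : ℤ) (hr : ev r (Fl ++ [1]) % p = 0) :
    ∃ i, φ (b i) = r ∧ ρ σ i = i := by
  have h1 : ev (r : k) (Fl ++ [1]) = 0 := by
    have := map_ev (Int.castRingHom k) r (Fl ++ [1])
    rw [eq_intCast, eq_intCast] at this
    rw [← this]
    obtain ⟨c, hc⟩ := Int.dvd_of_emod_eq_zero hr
    rw [hc]; push_cast; rw [hpk, zero_mul]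
  have h2 : toP k (Fl ++ [1]) = ∏ i, (X - C (φ (b i))) := by
    rw [← map_toP φ, hb, Polynomial.map_prod]; simp
  rw [← eval_toP, h2, eval_prod, Finset.prod_eq_zero_iff] at h1
  obtain ⟨i, -, hi⟩ := h1
  have hi' : φ (b i) = r := by
    simp [sub_eq_zero] at hi
    exact hi.symm
  refine ⟨i, hi', hinj ?_⟩
  change φ (b (ρ σ i)) = φ (b i)
  have hch : CharP k p := (CharP.charP_iff_prime_eq_zero hp).2 hpk
  have hf : Fact p.Prime := ⟨hp⟩
  rw [← hρ, hσ, hi', ← frobenius_def, map_intCast]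

end orders

set_option maxRecDepth 100000 in
theorem f13 : frobs 13 b13 11 = [0, 1, 0, 0, 0, 0, 0, 0, 0, 0, 0, 0] := by decide +kernel
set_option maxRecDepth 100000 in
theorem f19 : frobs 19 b19 5 = [0, 1, 0, 0, 0, 0, 0, 0, 0, 0, 0, 0] := by decide +kernel
set_option maxRecDepth 100000 in
theorem f31a : frobs 31 b31 4 = [8, 19, 20, 13, 15, 28, 4, 11, 21, 29, 16, 12] := by decide +kernel
set_option maxRecDepth 100000 in
theorem f31 : frobs 31 b31 8 = [0, 1, 0, 0, 0, 0, 0, 0, 0, 0, 0, 0] := by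
  rw [frobs, frobs, frobs, frobs, f31a]; decide +kernel
set_option maxRecDepth 100000 in
theorem f137 : frobs 137 b137 3 = [0, 1, 0, 0, 0, 0, 0, 0, 0, 0, 0, 0] := by decide +kernel

/-- the Frobenius elements -/
theorem elements (M : Type) [Field M] [NumberField M] [IsGalois ℚ M] (b : Fin 12 → 𝓞 M)
    (hb : toP (𝓞 M) (Fl ++ [1]) = ∏ i, (X - C (b i))) (ρ : (M ≃ₐ[ℚ] M) →* Equiv.Perm (Fin 12))
    (hρ : ∀ g i, g • b i = b (ρ g i)) :
    (∃ c, orderOf (ρ c) = 11) ∧ (∃ e, orderOf (ρ e) = 8 ∧ ∀ i, ρ e i ≠ i) ∧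
    (∃ t, orderOf (ρ t) = 5) ∧ (∃ u, orderOf (ρ u) = 3 ∧ ∃ x y, x ≠ y ∧ ρ u x = x ∧ ρ u y = y) := by
  refine ⟨?_, ?_, ?_, ?_⟩
  · obtain ⟨k, _, φ, σ, hpk, hσ⟩ := exists_frob M 13 (by norm_num)
    have : Fact (Nat.Prime 11) := ⟨by norm_num⟩
    refine ⟨σ, orderOf_eq_prime
      (rho_pow_one φ 13 (by norm_num) hpk b hb ρ hρ σ hσ b13 rfl 11 (by norm_num) f13) ?_⟩
    have := rho_pow_ne φ 13 (by norm_num) hpk b hb ρ hρ σ hσ b13 rfl 11 (by norm_num) f13 1 (by decide +kernel)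
    rwa [pow_one] at this
  · obtain ⟨k, _, φ, σ, hpk, hσ⟩ := exists_frob M 31 (by norm_num)
    have : Fact (Nat.Prime 2) := ⟨by norm_num⟩
    refine ⟨σ, orderOf_eq_prime_pow (p := 2) (n := 2)
      (rho_pow_ne φ 31 (by norm_num) hpk b hb ρ hρ σ hσ b31 rfl 8 (by norm_num) f31 4 ?_)
      (rho_pow_one φ 31 (by norm_num) hpk b hb ρ hρ σ hσ b31 rfl 8 (by norm_num) f31), ?_⟩
    · have := f31a
      push_cast
      rw [this]; decide
    · exact rho_no_fix φ 31 hpk b hb ρ hρ σ hσ b31 rfl [12, 7, 30, 6, 12, 23, 22, 6, 22, 14, 23, 7]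
        (by decide +kernel)
  · obtain ⟨k, _, φ, σ, hpk, hσ⟩ := exists_frob M 19 (by norm_num)
    have : Fact (Nat.Prime 5) := ⟨by norm_num⟩
    refine ⟨σ, orderOf_eq_prime
      (rho_pow_one φ 19 (by norm_num) hpk b hb ρ hρ σ hσ b19 rfl 5 (by norm_num) f19) ?_⟩
    have := rho_pow_ne φ 19 (by norm_num) hpk b hb ρ hρ σ hσ b19 rfl 5 (by norm_num) f19 1 (by decide +kernel)
    rwa [pow_one] at this
  · obtain ⟨k, _, φ, σ, hpk, hσ⟩ := exists_frob M 137 (by norm_num)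
    have : Fact (Nat.Prime 3) := ⟨by norm_num⟩
    refine ⟨σ, orderOf_eq_prime
      (rho_pow_one φ 137 (by norm_num) hpk b hb ρ hρ σ hσ b137 rfl 3 (by norm_num) f137) ?_, ?_⟩
    · have := rho_pow_ne φ 137 (by norm_num) hpk b hb ρ hρ σ hσ b137 rfl 3 (by norm_num) f137 1 (by decide +kernel)
      rwa [pow_one] at this
    · have hinj := red_inj φ 137 (by norm_num) hpk b hb b137 rfl 3 (by norm_num) f137
      obtain ⟨x, hx, hx'⟩ := rho_fix φ 137 (by norm_num) hpk b hb ρ hρ σ hσ hinj 33 (by decide +kernel)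
      obtain ⟨y, hy, hy'⟩ := rho_fix φ 137 (by norm_num) hpk b hb ρ hρ σ hσ hinj 81 (by decide +kernel)
      refine ⟨x, y, ?_, hx', hy'⟩
      rintro rfl
      apply cast_ne 137 (by norm_num) hpk (33 - 81) (by norm_num)
      rw [Int.cast_sub, ← hx, ← hy, sub_self]
end M11

namespace M11
open Polynomial NumberField

/-- resolvent polynomial (without the leading coefficient) -/
def gl : List ℤ := [-5572562780160000, -19436659015680000, -19099590082560000, -3308043939840000, -215071705440000, 3611434514625, -97609548150, 1941476175, -19307700, 140175, -630]
def grel : List ℤ := gl.map Neg.neg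
def DD : ℤ := 3394895688009551420796375395495264878536846355043136307200
def DU : List (List ℤ) := [[-308166491287876955966859144594356149281694952859946930352947200, -625298563958743034576536357009154087416304297476778690504294400, -115799441953897949741001787687607600486779515989024312052940800, -7932261199691549291185127804521415315829387105499268489625600, 134037455000597611335266062056016752831444944562347175936000, -3606495628744573123151523472881298162634547663974148096000, 71293174459277925092560057418136938958389892758401351680, -707815319311843002876526164498852521726671670729490432, 5129948231566785297456219583033684932123831037624320, -23014397830127198712542834514559368242513010278400, 36494833111014724355587537833034089993109733376],
  [-38623395204176568476428909020775134216596169581162268092006400, -46469119334545834737999567206690025261194244994856362652467200, -8457945689803212161034578026040111652342067689842750993203200, -556381436576510843977338203733777672827399966270103648460800, 9359928362314544571356548687264930463196719886742991040000, -252811422159191258507656443817783932939348069064515916800, 5020314542882451789815706912017242742724104980625748480, -49904829710253530822862161278487644482697164971046912, 362140207384090504112871528196734417813107989541376, -1626727402408478373719039784938246352029122089984, 2581335974707701348020241007645456056438910464],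
  [15539443771417540505228904558008152382993748123371811373056000, 23741851440462338629994283867676956061056789696728297530982400, 4417279623391708882743106329400429584895089489558087322828800, 295043418188119256493294240031638531631255433692294935244800, -4973061224810345817514807793760472572118363841332297708800, 134143402817964089781979173713654786630041559901262886400, -2658904672158939033633181382748720199053085883605021440, 26417822241139152063055690669708019804449987342795776, -191605145497462815885314035147228467924940017666816, 860222155590049020903215926731102346515970979328, -1364622162935710666537173978064047866010856704],
  [1118787887976389242850941362357649083559748308740370071552000, 1739725356713622728114245635973925533007822517719137202995200, 319132703682845609992395677446517086660219241090754084864000, 21124410434684033430914939692520556057609804129926907244800, -355499746525020762889163460848269331485528578240775053600, 9598616128086072121525781986720502765761394380159243200, -190504325136913825050671733889277925414807203646209760, 1893455552060205246998951653696492231763185314601344, -13738040704000930221359951961155122487815571786976, 61700610627816015226468180413715273357110908352, -97898912027234530296372086961562115073836832],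
  [25461717660071635655972815466214486589026347662823522304000, 1697447844004775710398187697747632439268423177521568153600, 0, 0, 0, 0, 0, 0, 0, 0, 0],
  [-40738748256114617049556504745943178542442156260517635686400, 0, 0, 0, 0, 0, 0, 0, 0, 0, 0],
  [3394895688009551420796375395495264878536846355043136307200, 0, 0, 0, 0, 0, 0, 0, 0, 0, 0]]
def DV : List (List ℤ) := [[-341267814330246906569920844753945315872890480317563074615705600, -540276042345511272198566587510711403979114827518387233069465600, -98409747812380966085656350053522798471465643764128385448345600, -6660188682112611890957970902472687234803524328755665432883200, 112382138888359151796820293840235902173093724109422578803200, -3026878687940574341522361298073452653466792172840157527040, 59919087517121021624353406356304333724569274215758880256, -595117211469613918201520382501000209651998639574956032, 4314852240262697801209604990573857814359412500938240, -19365635162937632388509359363348280757192375573504, 30715776428569023333183026209154798450511020544],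
  [133692650560639658333982059478909153523978527935284169932800000, 261874570075270421116485095103805599701808852355510018139750400, 48520008657461902178481183832810716958991239079096025142886400, 3332333225729780498669759047452766829108517455435512712294400, -56325049900871830920814836901263164040837956045719124880000, 1515126156529842824643667643370283167267598748246260442880, -29942331696600105682390462027120011001987514970420354432, 297250705192827409853415392925564974248959757222507008, -2154177213672837271901707992795575372767542133742976, 9663479074283071925533915383855404448052036912896, -15323103061695269250932556841705562132174367360],
  [-25316423133753318569766127651733007680986547122465432141824000, -50396460715394674413282409539729683760835790708766932808499200, -9376941526909613747629956390871938068555510856454481725747200, -644521613390633590955595849153939445648409734423749063744000, 10895478012275785078844585213042673586368119132707771078800, -293073990343234658673439409869723584086436194969091416160, 5791174307021985811810291376970805910551307509477502064, -57489866095258026359495548208940645846403866020416320, 416615757028719211425736135006143970400433975409776, -1868837915964311766130194565994535241299200099424, 2963301071316364121554896445552496790254745744],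
  [-4311181347475199712899017572454930049702410139055739502592000, -9113403230374069501502876868414716001045522914193177889996800, -1688157572857106243120403079341006944342610992604639152179200, -115315841614573742752285882164592931460653757547123187116800, 1947998455666531450643742810737910616316979257862107129400, -52429327562246006330385961015825963074835009199648041680, 1036741262700706221793843925425891325186057666906069832, -10293888232868045667531026574703648548187499955354720, 74612012808389750163039197058198658132474228412232, -334758163200259130370591267510012204010683349200, 530862502557962982345139757643835421013705272],
  [1472420153144312785658221635278985108641505657236005060608000, 2817291914280505201809165105417957072649937091424975405056000, 522103502068660457206003253495095713671983456346682239635200, 35673335818060471128326503961559392140558146222396401133600, -602647580470789365696078192282781845372660543206192676825, 16219381826831710386650351693223065087077335417909614310, -320711484846809784986936499235423686682346982205763319, 3184337270032291018944592513619406814550705179605876, -23080431322783746715764550102675063384986955518327, 103552868404862878128220335782518182841500104742, -164214237290215307298292005865962890041946457],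
  [-3394895688009551420796375395495264878536846355043136307200, 0, 0, 0, 0, 0, 0, 0, 0, 0, 0]]
def rt (i : Fin 12) : ℤ := ([253, 1283, 1585, 3805, 3811, 4990, 5080, 5991, 6153, 6650, 6659, 6901] : List ℤ).getD i 0
def st (j : Fin 11) : ℤ := ([7373, 3292, 3935, 1669, 5283, 1235, 6918, 502, 2065, 1583, 4730] : List ℤ).getD j 0
def tA (j : Fin 11) (i : Fin 12) : ℤ := (([[2620, 1405, 2796, 1786, 3730, 3904, 6098, 6824, 2493, 5920, 4776, 5691],
  [108, 3708, 2259, 2114, 429, 1459, 6195, 1067, 7585, 6812, 3974, 1875],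
  [2625, 1920, 172, 2074, 1286, 3964, 1059, 4953, 728, 1686, 6536, 609],
  [4553, 6334, 1838, 1890, 3910, 6748, 1513, 2942, 3105, 6770, 5690, 1693],
  [2819, 976, 4819, 4911, 280, 2935, 6508, 6092, 5569, 193, 3074, 3216],
  [5857, 7396, 5409, 725, 5679, 1400, 6324, 5163, 2150, 1691, 187, 377],
  [2010, 3766, 189, 6207, 263, 6993, 6646, 4411, 1531, 6646, 5164, 6872],
  [2703, 2419, 3469, 6350, 1077, 5022, 3971, 7373, 569, 3466, 1162, 5005],
  [7537, 1820, 4509, 2048, 2415, 6056, 6832, 3851, 7102, 5793, 5564, 6759],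
  [1810, 459, 4159, 5755, 3634, 6331, 2051, 198, 7522, 5278, 1677, 7452],
  [7269, 6630, 5685, 4973, 583, 4133, 3432, 1786, 4336, 552, 1073, 5659]] : List (List ℤ)).getD j []).getD i 0
def tB (j : Fin 11) (i : Fin 12) : ℤ := (([[6028, 2769, 3615, 4606, 2428, 6872, 5848, 1179, 5956, 2083, 3664, 2691],
  [1538, 2198, 4520, 3914, 1060, 394, 762, 690, 758, 2261, 3573, 6037],
  [5563, 4780, 3051, 688, 1462, 2594, 4297, 1665, 5146, 3868, 5518, 4600],
  [3957, 2643, 4288, 7543, 2913, 166, 424, 1858, 2090, 6799, 7326, 1513],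
  [6531, 814, 4968, 5844, 5709, 1021, 2101, 6679, 2638, 5372, 1786, 6651],
  [3765, 7207, 4764, 6683, 1023, 5418, 4130, 2109, 3066, 7531, 3836, 5297],
  [6722, 4996, 7362, 2219, 2292, 6709, 6446, 4094, 7237, 6446, 2361, 1619],
  [5937, 4437, 2954, 1571, 2374, 5550, 6540, 403, 1699, 3552, 2309, 1577],
  [2866, 7430, 3601, 4607, 5031, 1470, 1889, 837, 1037, 5505, 1026, 3110],
  [7361, 5804, 5343, 7148, 1761, 2524, 2759, 2206, 2609, 5284, 2352, 6686],
  [7041, 4659, 5283, 6452, 1373, 1946, 3662, 1589, 7210, 6365, 2540, 4291]] : List (List ℤ)).getD j []).getD i 0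

theorem ev2_zero {R : Type*} [CommRing R] (x y : R) (L : List (List ℤ))
    (h : (L.all fun l => l.all fun c => c == 0) = true) : ev2 x y L = 0 := by
  have h1 : ∀ l : List ℤ, (l.all fun c => c == 0) = true → ev y l = 0 := by
    intro l hl
    induction l with
    | nil => rfl
    | cons a l ih =>
      rw [List.all_cons, Bool.and_eq_true] at hl
      rw [ev_cons, ih hl.2, show a = 0 by simpa using hl.1]; simp
  induction L with
  | nil => rfl
  | cons a L ih =>
    rw [List.all_cons, Bool.and_eq_true] at h
    rw [ev2_cons, ih h.2, h1 a h.1]; simp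

set_option maxRecDepth 100000 in
theorem key_identity : ((addB (mulB 11 grel DU DU) (addB (mulB 11 grel [[0, -1]] (mulB 11 grel DV DV))
    (constB (smulL (-(DD * DD)) (Fl ++ [1]))))).all fun l => l.all fun c => c == 0) = true := by
  decide +kernel

theorem tA_ok : ∀ j i, ev2 (rt i) (st j) DU % 7591 = tA j i := by decide +kernel
theorem tB_ok : ∀ j i, ev2 (rt i) (st j) DV % 7591 = tB j i := by decide +kernel

theorem R_ok : ∀ j i i', if R j i i' then (tA j i * tB j i' + tA j i' * tB j i) % 7591 ≠ 0
    else (tA j i * tB j i' - tA j i' * tB j i) % 7591 ≠ 0 := by decide +kernel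

theorem rt_ok : modL (7591 : ℕ) (prodL (List.ofFn rt)) = modL (7591 : ℕ) (Fl ++ [1]) := by decide +kernel
theorem st_ok : modL (7591 : ℕ) (prodL (List.ofFn st)) = modL (7591 : ℕ) (gl ++ [1]) := by decide +kernel
theorem rt_ne : ∀ i j, i ≠ j → (rt i - rt j) % (7591 : ℕ) ≠ 0 := by decide +kernel
theorem st_ne : ∀ i j, i ≠ j → (st i - st j) % (7591 : ℕ) ≠ 0 := by decide +kernel

theorem pow11 {O : Type*} [CommRing O] (y : O) (hy : ev y (gl ++ [1]) = 0) : y ^ 11 = ev y grel := by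
  have h1 : grel = smulL (-1) gl := by decide +kernel
  rw [h1, ev_smulL]
  rw [ev_append, show gl.length = 11 from rfl] at hy
  simp only [ev_cons, ev_nil] at hy
  push_cast at hy ⊢
  linear_combination hy

theorem A_sq {O : Type*} [CommRing O] (x y : O) (hx : ev x (Fl ++ [1]) = 0) (hy : ev y (gl ++ [1]) = 0) :
    ev2 x y DU ^ 2 = y * ev2 x y DV ^ 2 := by
  have h := ev2_zero x y _ key_identity
  have hr := pow11 y hy
  rw [ev2_addB, ev2_mulB _ _ _ _ hr, ev2_addB, ev2_mulB _ _ _ _ hr, ev2_mulB _ _ _ _ hr, ev2_constB, ev_smulL, hx] at h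
  simp at h
  linear_combination h

theorem red_table {O k : Type*} [CommRing O] [Field k] (φ : O →+* k) (hpk : ((7591 : ℕ) : k) = 0)
    (x y : O) (r s t : ℤ) (hx : φ x = r) (hy : φ y = s) (L : List (List ℤ)) (h : ev2 r s L % 7591 = t) :
    φ (ev2 x y L) = t := by
  have h1 := map_ev2 (Int.castRingHom k) r s L
  rw [eq_intCast, eq_intCast, eq_intCast] at h1
  rw [map_ev2, hx, hy, ← h1, ← h]
  conv_lhs => rw [← Int.emod_add_mul_ediv (ev2 r s L) 7591]
  have : (7591 : k) = 0 := by exact_mod_cast hpk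
  push_cast
  rw [this]; ring

theorem rel_iff {O k : Type*} [CommRing O] [IsDomain O] [Field k] (φ : O →+* k)
    (hpk : ((7591 : ℕ) : k) = 0) (b : Fin 12 → O) (y : Fin 11 → O)
    (hb : ∀ i, φ (b i) = rt i) (hy : ∀ j, φ (y j) = st j) (hb0 : ∀ i, ev (b i) (Fl ++ [1]) = 0)
    (hy0 : ∀ j, ev (y j) (gl ++ [1]) = 0) (j : Fin 11) (i i' : Fin 12) :
    ev2 (b i) (y j) DU * ev2 (b i') (y j) DV = ev2 (b i') (y j) DU * ev2 (b i) (y j) DV ↔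
      R j i i' = true := by
  have hp : Nat.Prime 7591 := by norm_num
  have e1 := A_sq (b i) (y j) (hb0 i) (hy0 j)
  have e2 := A_sq (b i') (y j) (hb0 i') (hy0 j)
  have a1 := red_table φ hpk _ _ _ _ _ (hb i) (hy j) DU (tA_ok j i)
  have a2 := red_table φ hpk _ _ _ _ _ (hb i') (hy j) DU (tA_ok j i')
  have b1 := red_table φ hpk _ _ _ _ _ (hb i) (hy j) DV (tB_ok j i)
  have b2 := red_table φ hpk _ _ _ _ _ (hb i') (hy j) DV (tB_ok j i')
  have hR := R_ok j i i'
  generalize ev2 (b i) (y j) DU = A at *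
  generalize ev2 (b i') (y j) DU = A' at *
  generalize ev2 (b i) (y j) DV = B at *
  generalize ev2 (b i') (y j) DV = B' at *
  constructor
  · intro h
    by_contra hf
    rw [if_neg hf] at hR
    apply cast_ne 7591 hp hpk _ hR
    have := congrArg φ h
    rw [map_mul, map_mul, a1, a2, b1, b2] at this
    push_cast
    rw [this, sub_self]
  · intro h
    rw [if_pos h] at hR
    have h0 : (A * B' - A' * B) * (A * B' + A' * B) = 0 := by
      linear_combination B' ^ 2 * e1 - B ^ 2 * e2
    rcases mul_eq_zero.1 h0 with h1 | h1
    · exact sub_eq_zero.1 h1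
    · exfalso
      apply cast_ne 7591 hp hpk _ hR
      have := congrArg φ h1
      rw [map_add, map_mul, map_mul, a1, a2, b1, b2, map_zero] at this
      push_cast
      exact this

/-- labelled roots and the permutation representation of the big Galois group -/
theorem setup (M : Type) [Field M] [NumberField M] [IsGalois ℚ M]
    (hF : (toP M (Fl ++ [1])).Splits) (hg : (toP M (gl ++ [1])).Splits) :
    ∃ (b : Fin 12 → 𝓞 M) (ρ : (M ≃ₐ[ℚ] M) →* Equiv.Perm (Fin 12)),
      Function.Injective b ∧ (toP (𝓞 M) (Fl ++ [1]) = ∏ i, (X - C (b i))) ∧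
      (∀ g i, g • b i = b (ρ g i)) ∧ ∀ g, Pres (ρ g) := by
  have hp : Nat.Prime 7591 := by norm_num
  obtain ⟨k, _, φ, -, hpk, -⟩ := exists_frob M 7591 hp
  obtain ⟨s, hs⟩ := lift_split M Fl hF
  obtain ⟨s', hs'⟩ := lift_split M gl hg
  obtain ⟨b, hb1, hb2, hb3, hb4, hb5⟩ := label φ 7591 hp hpk _ s hs rt rt_ok rt_ne
  obtain ⟨y, hy1, hy2, hy3, hy4, hy5⟩ := label φ 7591 hp hpk _ s' hs' st st_ok st_ne
  obtain ⟨ρ, hρ⟩ := exists_rho (G := M ≃ₐ[ℚ] M) _ b hb4 hb2 hb3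
  obtain ⟨ρ', hρ'⟩ := exists_rho (G := M ≃ₐ[ℚ] M) _ y hy4 hy2 hy3
  refine ⟨b, ρ, hb4, hb5, hρ, ?_⟩
  intro g j
  refine ⟨ρ' g j, ?_⟩
  intro i i'
  have hm : ∀ i L, g • ev2 (b i) (y j) L = ev2 (b (ρ g i)) (y (ρ' g j)) L := by
    intro i L
    have := map_ev2 (MulSemiringAction.toRingHom (M ≃ₐ[ℚ] M) (𝓞 M) g) (b i) (y j) L
    rw [← hρ, ← hρ']
    exact this
  rw [Bool.eq_iff_iff, ← rel_iff φ hpk b y hb1 hy1 hb2 hy2, ← rel_iff φ hpk b y hb1 hy1 hb2 hy2,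
    ← hm, ← hm, ← hm, ← hm, ← smul_mul', ← smul_mul']
  exact (MulAction.injective g).eq_iff.symm
end M11

namespace M11
open Polynomial NumberField

theorem toP_F : toP ℚ (Fl ++ [1]) = C (4 ^ 12) * f1.comp (C (1 / 4) * X) := by
  have h4 : (X : ℚ[X]) = 4 * (C (1 / 4) * X) := by
    rw [← mul_assoc, show (4 : ℚ[X]) = C 4 from rfl, ← C_mul]; norm_num
  have h16 : 16 * C (1 / 16 : ℚ) = 1 := by
    rw [show (16 : ℚ[X]) = C 16 from rfl, ← C_mul]; norm_num
  have h25 : C (25 / 4 : ℚ) = 100 * C (1 / 16 : ℚ) := by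
    rw [show (100 : ℚ[X]) = C 100 from rfl, ← C_mul]; norm_num
  have hc : (C (4 ^ 12 : ℚ)) = 4 ^ 12 := by rw [C_pow]; rfl
  have hcomp : ∀ t : ℚ[X], f1.comp t = (t ^ 2 - t - 1) ^ 5 * (t ^ 2 - t - C (1 / 16 : ℚ)) -
      100 * C (1 / 16 : ℚ) * (t ^ 3 * (t - 1) ^ 3 * (t ^ 3 - 2)) := by
    intro t
    rw [← h25, f1]
    simp only [sub_comp, mul_comp, pow_comp, X_comp, C_comp, one_comp, ofNat_comp]
    rfl
  rw [hcomp, hc, toP]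
  generalize C (1 / 4 : ℚ) * X = t at *
  rw [h4]
  generalize C (1 / 16 : ℚ) = c at *
  simp only [Fl, List.cons_append, List.nil_append, ev_cons, ev_nil]
  push_cast
  linear_combination (4 ^ 10 * ((t ^ 2 - t - 1) ^ 5 + 100 * (t ^ 3 * (t - 1) ^ 3 * (t ^ 3 - 2)))) * h16

theorem f1_eq : f1 = C ((4 ^ 12)⁻¹) * (toP ℚ (Fl ++ [1])).comp (C 4 * X) := by
  rw [toP_F, mul_comp, C_comp, comp_assoc, mul_comp, C_comp, X_comp, ← mul_assoc, ← mul_assoc,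
    ← C_mul, ← C_mul]
  norm_num

theorem f1_deg : f1.natDegree = 12 := by
  rw [f1_eq, natDegree_C_mul (by norm_num), natDegree_comp, (toP_monic ℚ Fl).2,
    natDegree_C_mul_X _ (by norm_num)]; rfl

theorem f1_monic : f1.Monic := by
  rw [f1_eq, Monic, leadingCoeff_mul, leadingCoeff_comp (by rw [natDegree_C_mul_X _ (by norm_num)]; norm_num),
    (toP_monic ℚ Fl).1.leadingCoeff, (toP_monic ℚ Fl).2, leadingCoeff_C, leadingCoeff_C_mul_X,
    show Fl.length = 12 from rfl]
  norm_num

theorem f1_root {A : Type*} [Field A] [Algebra ℚ A] (x : A) : aeval x f1 = 0 ↔ ev (4 * x) (Fl ++ [1]) = 0 := by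
  rw [f1_eq, map_mul, aeval_C, aeval_comp, aeval_toP, mul_eq_zero_iff_left]
  · simp
  · rw [map_ne_zero_iff _ (algebraMap ℚ A).injective]; norm_num

theorem main_group (M : Type) [Field M] [NumberField M] [IsGalois ℚ M]
    (hf : (f1.map (algebraMap ℚ M)).Splits) (hg : (toP M (gl ++ [1])).Splits) :
    Irreducible f1 ∧ IsSimpleGroup f1.Gal ∧ Nat.card f1.Gal = 7920 := by
  have hF : (toP M (Fl ++ [1])).Splits := by
    rw [← map_toP (algebraMap ℚ M), toP_F, Polynomial.map_mul, map_comp]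
    refine Splits.mul (by rw [Polynomial.map_C]; exact Splits.C _) (Splits.comp_of_natDegree_le_one hf ?_)
    rw [Polynomial.map_mul, Polynomial.map_C, map_X]
    exact (natDegree_C_mul_le _ _).trans natDegree_X_le
  obtain ⟨b, ρ, hinj, hprod, hρ, hpres⟩ := setup M hF hg
  obtain ⟨⟨c, hc⟩, ⟨e, he, hefix⟩, ⟨t, ht⟩, ⟨u, hu, x, y, hxy, hux, huy⟩⟩ := elements M b hprod ρ hρ
  have hord : ∀ g, orderOf (⟨ρ g, g, rfl⟩ : ρ.range) = orderOf (ρ g) := fun g => Subgroup.orderOf_mk _ _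
  obtain ⟨hcard, hsimple, htrans⟩ := gt ρ.range.subtype ρ.range.subtype_injective
    (by rintro ⟨_, g, rfl⟩; exact hpres g) ⟨ρ c, c, rfl⟩ ⟨ρ e, e, rfl⟩ ⟨ρ t, t, rfl⟩ ⟨ρ u, u, rfl⟩
    ((hord c).trans hc) ((hord e).trans he) ((hord t).trans ht) ((hord u).trans hu) hefix x y hxy hux huy
  have hfact : Fact ((f1.map (algebraMap ℚ M)).Splits) := ⟨hf⟩
  have hb0 : ∀ i, ev (b i : M) (Fl ++ [1]) = 0 := by
    intro i
    have := congrArg (algebraMap (𝓞 M) M) (root_b b hprod i)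
    rwa [map_ev, map_zero] at this
  have hρ' : ∀ (g : M ≃ₐ[ℚ] M) i, g (b i : M) = b (ρ g i) := fun g i =>
    congrArg (fun z : 𝓞 M => (z : M)) (hρ g i)
  have hroot : ∀ i, aeval ((b i : M) / 4) f1 = 0 := by
    intro i
    rw [f1_root, mul_div_cancel₀ _ (by norm_num), hb0]
  have hne : f1 ≠ 0 := f1_monic.ne_zero
  have hall : ∀ z : M, aeval z f1 = 0 → ∃ i, z = (b i : M) / 4 := by
    intro z hz
    rw [f1_root, ← eval_toP, ← map_toP (algebraMap (𝓞 M) M), hprod, Polynomial.map_prod, eval_prod,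
      Finset.prod_eq_zero_iff] at hz
    obtain ⟨i, -, hi⟩ := hz
    simp [sub_eq_zero] at hi
    exact ⟨i, by rw [eq_div_iff (by norm_num), mul_comm, hi]⟩
  have hker : (Gal.restrict f1 M).ker = ρ.ker := by
    ext τ
    rw [MonoidHom.mem_ker, MonoidHom.mem_ker, ← (Gal.galActionHom_injective f1 M).eq_iff, map_one]
    constructor
    · intro h
      ext i
      congr 1
      apply hinj
      apply RingOfIntegers.ext
      rw [← hρ']
      have h1 := Gal.galActionHom_restrict f1 M τ ⟨(b i : M) / 4, by
        rw [mem_rootSet]; exact ⟨hne, hroot i⟩⟩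
      rw [h] at h1
      simp only [Equiv.Perm.coe_one, id_eq, map_div₀, map_ofNat] at h1
      have h2 : τ (b i : M) = b i := by
        field_simp at h1
        exact h1.symm
      exact h2
    · intro h
      ext z
      rw [Gal.galActionHom_restrict]
      obtain ⟨i, hi⟩ := hall z ((mem_rootSet.1 z.2).2)
      simp only [Equiv.Perm.coe_one, id_eq]
      rw [hi, map_div₀, hρ', h, map_ofNat]; rfl
  have E : f1.Gal ≃* ρ.range :=
    ((QuotientGroup.quotientKerEquivOfSurjective _ (Gal.restrict_surjective f1 M)).symm.trans
      (QuotientGroup.quotientMulEquivOfEq hker)).trans (QuotientGroup.quotientKerEquivRange ρ)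
  refine ⟨?_, ?_, ?_⟩
  · have hint : IsIntegral ℚ ((b 0 : M) / 4) := Algebra.IsIntegral.isIntegral _
    have hd : 12 ≤ (minpoly ℚ ((b 0 : M) / 4)).natDegree := by
      by_contra hlt
      push Not at hlt
      have h0 := Polynomial.eq_zero_of_natDegree_lt_card_of_eval_eq_zero
        ((minpoly ℚ ((b 0 : M) / 4)).map (algebraMap ℚ M)) (f := fun i : Fin 12 => (b i : M) / 4) ?_ ?_ ?_
      · exact (Polynomial.map_ne_zero (minpoly.ne_zero hint)) h0
      · intro i j hij
        apply hinj
        apply RingOfIntegers.ext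
        have : (b i : M) / 4 = (b j : M) / 4 := hij
        field_simp at this
        exact this
      · intro i
        obtain ⟨⟨_, g, rfl⟩, hg⟩ := htrans 0 i
        have hg' : ρ g 0 = i := hg
        rw [eval_map_algebraMap]
        have h1 := congrArg g (minpoly.aeval ℚ ((b 0 : M) / 4))
        rw [← aeval_algHom_apply, map_zero, map_div₀, hρ', hg', map_ofNat] at h1
        exact h1
      · rw [natDegree_map, Fintype.card_fin]; exact hlt
    have := eq_of_monic_of_dvd_of_natDegree_le (minpoly.monic hint) f1_monic
      (minpoly.dvd ℚ _ (hroot 0)) (by rw [f1_deg]; exact hd)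
    rw [this]
    exact minpoly.irreducible hint
  · exact E.isSimpleGroup_congr.2 hsimple
  · rw [Nat.card_congr E.toEquiv, hcard]

theorem group_aux (M : Type) [Field M] [CharZero M] [A : Algebra ℚ M] (q : ℚ[X])
    (hs : IsSplittingField ℚ M q) (hq : q ≠ 0) (h1 : f1 ∣ q) (h2 : toP ℚ (gl ++ [1]) ∣ q) :
    Irreducible f1 ∧ IsSimpleGroup f1.Gal ∧ Nat.card f1.Gal = 7920 := by
  obtain rfl : A = DivisionRing.toRatAlgebra := Subsingleton.elim _ _
  have hnf : NumberField M :=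
    { to_charZero := inferInstance, to_finiteDimensional := hs.finiteDimensional M q }
  have hgal : IsGalois ℚ M :=
    { to_isSeparable := inferInstance
      to_normal := Normal.of_isSplittingField q }
  have hne : q.map (algebraMap ℚ M) ≠ 0 := Polynomial.map_ne_zero hq
  refine main_group M (hs.splits.of_dvd hne ((map_dvd_map' _).2 h1)) ?_
  rw [← map_toP (algebraMap ℚ M)]
  exact hs.splits.of_dvd hne ((map_dvd_map' _).2 h2)

theorem group_part : Irreducible f1 ∧ IsSimpleGroup f1.Gal ∧ Nat.card f1.Gal = 7920 :=
  group_aux (f1 * toP ℚ (gl ++ [1])).SplittingField _ (IsSplittingField.splittingField _)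
    (f1_monic.mul (toP_monic ℚ gl).1).ne_zero (dvd_mul_right _ _) (dvd_mul_left _ _)
end M11

namespace M11
open Polynomial NumberField

theorem max_step {K : Type*} [Field K] [CharZero K] (S : Subring K) (p : ℕ) (hp : p ≠ 0) (π t : S) (s : ℤ)
    (hs : IsCoprime s (p : ℤ)) (hs0 : s ≠ 0) (hst : (s : S) * p = π * t) (q : ℕ) (hq : 2 ≤ q)
    (hfrob : ∀ z : S, z ^ q - z ∈ Ideal.span {π, (p : S)})
    (x : K) (hx : IsIntegral ℤ x) (h1 : (π : K) * x ∈ S) (h2 : (p : K) * x ∈ S) : x ∈ S := by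
  obtain ⟨f, hf, hfx⟩ := hx
  have hstK : (s : K) * p = π * t := by
    have := congrArg (S.subtype) hst
    simpa using this
  have hπ : (π : K) ≠ 0 := by
    intro h
    rw [h, zero_mul, mul_eq_zero] at hstK
    rcases hstK with h | h
    · exact hs0 (by exact_mod_cast h)
    · exact hp (by exact_mod_cast h)
  let w : S := ⟨(π : K) * x, h1⟩
  have hw : (w : K) = π * x := rfl
  -- `w` is nilpotent modulo `π`
  have hnil : π ∣ w ^ f.natDegree := by
    have h3 : w ^ f.natDegree = - ∑ j ∈ Finset.range f.natDegree,
        (f.coeff j : S) * w ^ j * π ^ (f.natDegree - j) := by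
      apply Subtype.ext
      have h4 := hfx
      rw [eval₂_eq_sum_range, Finset.sum_range_succ, hf.coeff_natDegree, map_one, one_mul] at h4
      have h5 : ((∑ j ∈ Finset.range f.natDegree, (f.coeff j : S) * w ^ j * π ^ (f.natDegree - j) : S) : K) =
          (π : K) ^ f.natDegree * ∑ j ∈ Finset.range f.natDegree, (algebraMap ℤ K) (f.coeff j) * x ^ j := by
        push_cast
        rw [Finset.mul_sum]
        apply Finset.sum_congr rfl
        intro j hj
        have hj' : j ≤ f.natDegree := (Finset.mem_range.1 hj).le
        rw [hw, mul_pow, ← Nat.sub_add_cancel hj', pow_add]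
        simp only [Nat.sub_add_cancel hj', eq_intCast]
        ring
      rw [Subring.coe_neg, h5, Subring.coe_pow, hw, mul_pow]
      linear_combination (π : K) ^ f.natDegree * h4
    rw [h3, dvd_neg]
    apply Finset.dvd_sum
    intro j hj
    apply Dvd.dvd.mul_left
    apply dvd_pow_self
    have := Finset.mem_range.1 hj
    omega
  have hmem : w ∈ Ideal.span {π, (p : S)} := by
    rw [← Ideal.Quotient.eq_zero_iff_mem]
    set ψ := Ideal.Quotient.mk (Ideal.span {π, (p : S)}) with hψ
    have h6 : ψ w ^ q = ψ w := by
      rw [← sub_eq_zero, ← map_pow, ← map_sub]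
      exact Ideal.Quotient.eq_zero_iff_mem.2 (hfrob w)
    have h7 : ∀ N, ψ w ^ (q ^ N) = ψ w := by
      intro N
      induction N with
      | zero => simp
      | succ N ih => rw [pow_succ, pow_mul, ih, h6]
    have h8 : ψ w ^ f.natDegree = 0 := by
      rw [← map_pow]
      obtain ⟨c, hc⟩ := hnil
      rw [hc, map_mul]
      have : ψ π = 0 := Ideal.Quotient.eq_zero_iff_mem.2 (Ideal.subset_span (by simp))
      rw [this, zero_mul]
    rw [← h7 f.natDegree]
    exact pow_eq_zero_of_le (Nat.lt_pow_self hq).le h8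
  rw [Ideal.mem_span_pair] at hmem
  obtain ⟨u, v, huv⟩ := hmem
  have h9 : (s : K) * x = s * u + t * v := by
    apply mul_left_cancel₀ hπ
    have h10 : (u : K) * π + v * p = π * x := by
      have := congrArg (S.subtype) huv
      simpa [w] using this
    linear_combination (-(s : K)) * h10 + v * hstK
  have h11 : (s : K) * x ∈ S := by
    rw [h9]
    exact S.add_mem (S.mul_mem (intCast_mem S s) u.2) (S.mul_mem t.2 v.2)
  obtain ⟨c, d, hcd⟩ := hs
  have h12 : x = c * (s * x) + d * (p * x) := by
    have := congrArg (Int.cast : ℤ → K) hcd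
    push_cast at this
    linear_combination (-x) * this
  rw [h12]
  exact S.add_mem (S.mul_mem (intCast_mem S c) h11) (S.mul_mem (intCast_mem S d) h2)

theorem max_all {K : Type*} [Field K] [CharZero K] (S : Subring K) (hS : ∀ x ∈ S, IsIntegral ℤ x)
    (p : ℕ) (hp : p ≠ 0) (π t : S) (s : ℤ)
    (hs : IsCoprime s (p : ℤ)) (hs0 : s ≠ 0) (hst : (s : S) * p = π * t) (q : ℕ) (hq : 2 ≤ q)
    (hfrob : ∀ z : S, z ^ q - z ∈ Ideal.span {π, (p : S)}) (n : ℕ) (hn : (p : S) ∣ π ^ n)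
    (x : K) (hx : IsIntegral ℤ x) (h2 : (p : K) * x ∈ S) : x ∈ S := by
  have h : ∀ m, (π : K) ^ m * x ∈ S → x ∈ S := by
    intro m
    induction m with
    | zero => simp
    | succ m ih =>
      intro hm
      apply ih
      apply max_step S p hp π t s hs hs0 hst q hq hfrob
      · exact ((hS _ π.2).pow m).mul hx
      · rwa [← mul_assoc, ← pow_succ']
      · rw [mul_left_comm]; exact S.mul_mem (S.pow_mem π.2 m) h2
  apply h n
  obtain ⟨v, hv⟩ := hn
  have : (π : K) ^ n = p * v := by
    have := congrArg (S.subtype) hv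
    simpa using this
  rw [this, mul_comm (p : K), mul_assoc]
  exact S.mul_mem v.2 h2

/-- linear combinations -/
def lin {R : Type*} [CommRing R] : List R → List ℤ → R
  | x :: v, a :: c => (a : R) * x + lin v c
  | _, _ => 0

def lc : List (List ℤ) → List ℤ → List ℤ
  | r :: rs, a :: as => addL (smulL a r) (lc rs as)
  | _, _ => []

section lin
variable {R : Type*} [CommRing R]

theorem lin_nil (c : List ℤ) : lin ([] : List R) c = 0 := by cases c <;> rfl
theorem lin_nil' (v : List R) : lin v [] = 0 := by cases v <;> rfl
theorem lin_cons (x : R) (v : List R) (a : ℤ) (c : List ℤ) : lin (x :: v) (a :: c) = a * x + lin v c := rfl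

theorem lin_addL (v : List R) (c d : List ℤ) : lin v (addL c d) = lin v c + lin v d := by
  induction v generalizing c d with
  | nil => simp [lin_nil]
  | cons x v ih =>
    cases c with
    | nil => simp [addL, lin_nil']
    | cons a c =>
      cases d with
      | nil => simp [addL, lin_nil']
      | cons b d => simp [addL, lin_cons, ih]; ring

theorem lin_smulL (v : List R) (a : ℤ) (c : List ℤ) : lin v (smulL a c) = a * lin v c := by
  induction v generalizing c with
  | nil => simp [lin_nil]
  | cons x v ih =>
    cases c with
    | nil => simp [smulL, lin_nil']
    | cons b c =>
      have : smulL a (b :: c) = (a * b) :: smulL a c := rfl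
      rw [this, lin_cons, lin_cons, ih]; push_cast; ring

theorem lin_lc (v : List R) (rs : List (List ℤ)) (c : List ℤ) :
    lin v (lc rs c) = lin (rs.map (lin v)) c := by
  induction rs generalizing c with
  | nil => cases c <;> simp [lc, lin_nil, lin_nil']
  | cons r rs ih =>
    cases c with
    | nil => simp [lc, lin_nil']
    | cons a c => simp [lc, lin_cons, lin_addL, lin_smulL, ih]

theorem ev_lc (y : R) (rs : List (List ℤ)) (c : List ℤ) :
    ev y (lc rs c) = lin (rs.map (ev y)) c := by
  induction rs generalizing c with
  | nil => cases c <;> simp [lc, lin_nil]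
  | cons r rs ih =>
    cases c with
    | nil => simp [lc, lin_nil']
    | cons a c => simp [lc, lin_cons, ev_addL, ev_smulL, ih]

theorem lin_mul (z : R) (v : List R) (c : List ℤ) : lin (v.map (z * ·)) c = z * lin v c := by
  induction v generalizing c with
  | nil => simp [lin_nil]
  | cons x v ih =>
    cases c with
    | nil => simp [lin_nil']
    | cons a c => simp [lin_cons, ih]; ring

theorem lin_mul' (z : R) (v : List R) (c : List ℤ) : lin (v.map (· * z)) c = lin v c * z := by
  rw [mul_comm, ← lin_mul]
  congr 2
  funext x; ring

theorem map_lin {A : Type*} [CommRing A] (φ : R →+* A) (v : List R) (c : List ℤ) :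
    φ (lin v c) = lin (v.map φ) c := by
  induction v generalizing c with
  | nil => simp [lin_nil]
  | cons x v ih =>
    cases c with
    | nil => simp [lin_nil']
    | cons a c => simp [lin_cons, ih]

theorem lin_modL (p : ℕ) (hp : (p : R) = 0) (v : List R) (c : List ℤ) : lin v (modL p c) = lin v c := by
  induction v generalizing c with
  | nil => simp [lin_nil]
  | cons x v ih =>
    cases c with
    | nil => simp [modL, lin_nil']
    | cons a c =>
      have h2 : modL p (a :: c) = (a % p) :: modL p c := rfl
      rw [h2, lin_cons, lin_cons, ih]
      congr 2
      conv_rhs => rw [← Int.emod_add_mul_ediv a p]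
      push_cast; rw [hp]; ring

theorem lin_pow (p : ℕ) (hp : p.Prime) (hpR : (p : R) = 0) (v : List R) (c : List ℤ) :
    lin v c ^ p = lin (v.map (· ^ p)) c := by
  rcases subsingleton_or_nontrivial R with h | h
  · exact Subsingleton.elim _ _
  have hch : CharP R p := (CharP.charP_iff_prime_eq_zero hp).2 hpR
  have hf : Fact p.Prime := ⟨hp⟩
  exact map_lin (frobenius R p) v c

def ee (i : ℕ) : List ℤ := List.replicate i 0 ++ [1]

theorem lin_ee (v : List R) (i : ℕ) : lin v (ee i) = v.getD i 0 := by
  induction v generalizing i with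
  | nil => simp [lin_nil]
  | cons x v ih =>
    cases i with
    | zero => simp [ee, lin_cons, lin_nil']
    | succ i =>
      have : ee (i + 1) = 0 :: ee i := rfl
      rw [this, lin_cons, ih]; simp

theorem lin_ofFn {n : ℕ} (f : Fin n → R) (c : List ℤ) :
    lin (List.ofFn f) c = ∑ i : Fin n, ((c.getD (i : ℕ) 0 : ℤ) : R) * f i := by
  induction n generalizing c with
  | zero => simp [lin_nil]
  | succ n ih =>
    cases c with
    | nil => simp [lin_nil']
    | cons a c => rw [List.ofFn_succ, lin_cons, ih, Fin.sum_univ_succ]; simp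

/-- `v` multiplies according to the structure constants `T` -/
def Rel (T : List (List (List ℤ))) (v : List R) : Prop :=
  T.map (List.map (lin v)) = v.map fun x => v.map (x * ·)

theorem Rel.map {A : Type*} [CommRing A] (φ : R →+* A) {T : List (List (List ℤ))} {v : List R} (h : Rel T v) :
    Rel T (v.map φ) := by
  have := congrArg (List.map (List.map φ)) h
  simp only [List.map_map] at this
  unfold Rel
  simp only [List.map_map]
  convert this using 2
  · funext l
    simp only [Function.comp_apply, List.map_map]
    congr 1
    funext c
    simp [map_lin]
  · funext x
    simp only [Function.comp_apply, List.map_map]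
    congr 1
    funext y
    simp

theorem Rel.of_map {A : Type*} [CommRing A] (φ : R →+* A) (hφ : Function.Injective φ)
    {T : List (List (List ℤ))} {v : List R} (h : Rel T (v.map φ)) : Rel T v := by
  apply List.map_injective_iff.2 (List.map_injective_iff.2 hφ)
  unfold Rel at h
  simp only [List.map_map] at h ⊢
  convert h using 2
  · funext l
    simp only [Function.comp_apply, List.map_map]
    congr 1
    funext c
    simp [map_lin]
  · funext x
    simp only [Function.comp_apply, List.map_map]
    congr 1
    funext y
    simp

def tmul (T : List (List (List ℤ))) (c d : List ℤ) : List ℤ := lc (T.map fun Ti => lc Ti d) c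

theorem Rel.tmul {T : List (List (List ℤ))} {v : List R} (h : Rel T v) (c d : List ℤ) :
    lin v (tmul T c d) = lin v c * lin v d := by
  have h1 : T.map (fun Ti => lin v (lc Ti d)) = v.map (· * lin v d) := by
    have := congrArg (List.map fun l => lin l d) h
    simp only [List.map_map] at this
    convert this using 2
    · funext l; simp [lin_lc]
    · funext x; simp [lin_mul]
  rw [M11.tmul, lin_lc, List.map_map]
  change lin (T.map (fun Ti => lin v (lc Ti d))) c = _
  rw [h1, lin_mul']

theorem Rel.row {T : List (List (List ℤ))} {v : List R} (h : Rel T v) (i : ℕ) (hi : i < v.length) (c : List ℤ) :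
    lin v (lc (T.getD i []) c) = v.getD i 0 * lin v c := by
  rw [lin_lc, ← lin_mul]
  congr 1
  have := congrArg (fun l => l.getD i []) h
  have hT : T.length = v.length := by simpa using congrArg List.length h
  rw [List.getD_eq_getElem _ _ (by simpa [hT] using hi), List.getD_eq_getElem _ _ (by simpa using hi)] at this
  rw [List.getD_eq_getElem _ _ (by omega), List.getD_eq_getElem _ _ hi]
  simpa using this

def rowPow (p : ℤ) (Ti : List (List ℤ)) (c : List ℤ) : ℕ → List ℤ
  | 0 => c
  | n + 1 => modL p (lc Ti (rowPow p Ti c n))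

theorem Rel.rowPow {T : List (List (List ℤ))} {v : List R} (h : Rel T v) (p : ℕ) (hp : (p : R) = 0)
    (i : ℕ) (hi : i < v.length) (n : ℕ) :
    lin v (rowPow p (T.getD i []) (ee i) n) = v.getD i 0 ^ (n + 1) := by
  induction n with
  | zero => simp [M11.rowPow, lin_ee]
  | succ n ih => rw [M11.rowPow, lin_modL p hp, h.row i hi, ih]; ring
end lin
end M11

namespace M11
open Polynomial NumberField

def ordS {K : Type*} [CommRing K] {T : List (List (List ℤ))} {v : List K} (h : Rel T v) (h1 : lin v [1] = 1) :
    Subring K where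
  carrier := {x | ∃ c : List ℤ, lin v c = x}
  mul_mem' := by
    rintro _ _ ⟨c, rfl⟩ ⟨d, rfl⟩
    exact ⟨_, h.tmul c d⟩
  one_mem' := ⟨_, h1⟩
  add_mem' := by
    rintro _ _ ⟨c, rfl⟩ ⟨d, rfl⟩
    exact ⟨_, lin_addL v c d⟩
  zero_mem' := ⟨[], lin_nil' v⟩
  neg_mem' := by
    rintro _ ⟨c, rfl⟩
    exact ⟨smulL (-1) c, by rw [lin_smulL]; simp⟩

theorem lin_mem_span {K : Type*} [CommRing K] (v : List K) (c : List ℤ) :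
    lin v c ∈ Submodule.span ℤ {x | x ∈ v} := by
  induction v generalizing c with
  | nil => rw [lin_nil]; exact Submodule.zero_mem _
  | cons x v ih =>
    cases c with
    | nil => rw [lin_nil']; exact Submodule.zero_mem _
    | cons a c =>
      rw [lin_cons, ← zsmul_eq_mul]
      refine Submodule.add_mem _ (Submodule.smul_mem _ _ (Submodule.subset_span (by simp)))
        (Submodule.span_mono ?_ (ih c))
      intro y hy
      exact List.mem_cons_of_mem _ hy

theorem mem_lin {K : Type*} [CommRing K] (v : List K) (x : K) (hx : x ∈ v) : ∃ c, lin v c = x := by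
  obtain ⟨i, hi, rfl⟩ := List.getElem_of_mem hx
  exact ⟨ee i, by rw [lin_ee, List.getD_eq_getElem _ _ hi]⟩

theorem mem_span_iff_S {K : Type*} [CommRing K] {T : List (List (List ℤ))} {v : List K} (h : Rel T v)
    (h1 : lin v [1] = 1) (x : K) : x ∈ Submodule.span ℤ {x | x ∈ v} ↔ x ∈ ordS h h1 := by
  constructor
  · intro hx
    induction hx using Submodule.span_induction with
    | mem x hx => exact mem_lin v x hx
    | zero => exact Subring.zero_mem _
    | add x y _ _ hx hy => exact Subring.add_mem _ hx hy
    | smul a x _ hx => rw [zsmul_eq_mul]; exact Subring.mul_mem _ (intCast_mem _ a) hx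
  · rintro ⟨c, rfl⟩
    exact lin_mem_span v c

theorem ordS_int {K : Type*} [Field K] {T : List (List (List ℤ))} {v : List K} (h : Rel T v)
    (h1 : lin v [1] = 1) (x : K) (hx : x ∈ ordS h h1) : IsIntegral ℤ x := by
  apply isIntegral_of_smul_mem_submodule (M := K) (N := Submodule.span ℤ {x | x ∈ v})
  · intro h0
    have : (1 : K) ∈ Submodule.span ℤ {x | x ∈ v} := (mem_span_iff_S h h1 1).2 (Subring.one_mem _)
    rw [h0, Submodule.mem_bot] at this
    exact one_ne_zero this
  · exact Submodule.fg_span (List.finite_toSet v)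
  · intro n hn
    rw [mem_span_iff_S h h1] at hn ⊢
    exact Subring.mul_mem _ hx hn

theorem frob_ok {A : Type*} [CommRing A] (p : ℕ) (hp : p.Prime) (hpA : (p : A) = 0)
    {T : List (List (List ℤ))} {v : List A} (hv : Rel T v) (hlen : v.length = 12)
    (Φ U : List (List ℤ)) (pi : List ℤ) (hpi : lin v pi = 0) (hΦ : Φ.length = 12)
    (h1 : ∀ i < 12, Φ.getD i [] = rowPow p (T.getD i []) (ee i) (p - 1))
    (h2 : ∀ i < 12, modL p (lc Φ (Φ.getD i [])) = modL p (addL (ee i) (tmul T (U.getD i []) pi)))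
    (c : List ℤ) : lin v c ^ (p ^ 2) = lin v c := by
  have e1 : v.map (· ^ p) = Φ.map (lin v) := by
    apply List.ext_getElem (by simp [hlen, hΦ])
    intro i hi hi'
    have hi1 : i < v.length := by simpa using hi
    have hi2 : i < Φ.length := by omega
    have := hv.rowPow p hpA i hi1 (p - 1)
    rw [Nat.sub_add_cancel hp.one_le, ← h1 i (by omega), List.getD_eq_getElem _ _ hi1,
      List.getD_eq_getElem _ _ hi2] at this
    simpa using this.symm
  have e3 : ∀ d, lin v d ^ p = lin v (lc Φ d) := by
    intro d
    rw [lin_pow p hp hpA, e1, lin_lc]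
  have e2 : (v.map (· ^ p)).map (· ^ p) = v := by
    apply List.ext_getElem (by simp)
    intro i hi hi'
    have hi2 : i < Φ.length := by omega
    simp only [e1, List.getElem_map]
    rw [e3, ← lin_modL p hpA]
    have := h2 i (by omega)
    rw [List.getD_eq_getElem _ _ hi2] at this
    rw [this, lin_modL p hpA, lin_addL, hv.tmul, hpi, mul_zero, add_zero, lin_ee, List.getD_eq_getElem _ _ hi']
  rw [pow_two, pow_mul, lin_pow p hp hpA, lin_pow p hp hpA, e2]

def tpow (T : List (List (List ℤ))) (c : List ℤ) : ℕ → List ℤ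
  | 0 => c
  | n + 1 => tmul T c (tpow T c n)

theorem Rel.tpow {R : Type*} [CommRing R] {T : List (List (List ℤ))} {v : List R} (h : Rel T v) (c : List ℤ) (n : ℕ) :
    lin v (tpow T c n) = lin v c ^ (n + 1) := by
  induction n with
  | zero => simp [M11.tpow]
  | succ n ih => rw [M11.tpow, h.tmul, ih]; ring

theorem max_prime {K : Type*} [Field K] [CharZero K] {T : List (List (List ℤ))} {v : List K} (h : Rel T v)
    (h1 : lin v [1] = 1) (hlen : v.length = 12) (p : ℕ) (hp : p.Prime) (pi tp Q : List ℤ) (s : ℤ) (n : ℕ)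
    (Φ U : List (List ℤ)) (hs : IsCoprime s (p : ℤ)) (hs0 : s ≠ 0)
    (hst : tmul T pi tp = addL (smulL (s * p) [1]) (smulL 0 pi))
    (hn : tpow T pi n = smulL p Q) (hΦ : Φ.length = 12)
    (hp1 : ∀ i < 12, Φ.getD i [] = rowPow p (T.getD i []) (ee i) (p - 1))
    (hp2 : ∀ i < 12, modL p (lc Φ (Φ.getD i [])) = modL p (addL (ee i) (tmul T (U.getD i []) pi)))
    (x : K) (hx : IsIntegral ℤ x) (h2 : (p : K) * x ∈ ordS h h1) : x ∈ ordS h h1 := by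
  obtain ⟨vS, hvS⟩ : ∃ vS : List (ordS h h1), vS.map (ordS h h1).subtype = v :=
    have hm : ∀ x ∈ v, x ∈ ordS h h1 := fun x hx => mem_lin v x hx
    ⟨v.pmap Subtype.mk hm, by
      apply List.ext_getElem
      · simp
      · intro i h h'
        simp⟩
  have hS : ∀ c, ((lin vS c : ordS h h1) : K) = lin v c := by
    intro c
    have := map_lin (ordS h h1).subtype vS c
    rw [hvS] at this
    exact this
  have hR : Rel T vS := Rel.of_map (ordS h h1).subtype Subtype.val_injective (by rw [hvS]; exact h)
  have hS1 : lin vS [1] = 1 := Subtype.ext (by rw [hS, h1]; rfl)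
  refine max_all (ordS h h1) (ordS_int h h1) p hp.ne_zero (lin vS pi) (lin vS tp) s hs hs0 ?_ (p ^ 2) ?_ ?_ (n + 1) ?_
    x hx h2
  · rw [← hR.tmul, hst, lin_addL, lin_smulL, lin_smulL, hS1]; push_cast; ring
  · have := hp.two_le
    nlinarith
  · rintro ⟨_, c, rfl⟩
    have hz : (⟨lin v c, c, rfl⟩ : ordS h h1) = lin vS c := Subtype.ext (hS c).symm
    rw [hz]
    set I := Ideal.span {lin vS pi, (p : ordS h h1)} with hI
    rw [← Ideal.Quotient.eq_zero_iff_mem, map_sub, map_pow, map_lin, sub_eq_zero]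
    have hpI : ((p : ℕ) : ordS h h1 ⧸ I) = 0 := by
      rw [← map_natCast (Ideal.Quotient.mk I)]
      exact Ideal.Quotient.eq_zero_iff_mem.2 (Ideal.subset_span (by simp))
    refine frob_ok p hp hpI (hR.map _) ?_ Φ U pi ?_ hΦ hp1 hp2 c
    · have := congrArg List.length hvS
      simpa [hlen] using this
    · rw [← map_lin]
      exact Ideal.Quotient.eq_zero_iff_mem.2 (Ideal.subset_span (by simp))
  · rw [← hR.tpow, hn, lin_smulL]
    exact ⟨lin vS Q, by push_cast; rfl⟩
end M11

namespace M11
open Polynomial NumberField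

def NN : ℤ := 1009254400
def Wl : List (List ℤ) := [[1009254400,0,0,0,0,0,0,0,0,0,0,0],
  [-6082002944,-15863513088,7920353280,-3307274240,1492290560,-316706816,12716928,3227360,604220,-304030,32044,-1042],
  [3651928064,6780878848,-2286714880,956047360,-426122240,69789696,1579392,-849760,-293180,75270,-4364,42],
  [6710624256,11980767232,-5577441280,2453913600,-1131617280,247906304,-12186112,-2356160,-402700,227690,-27116,998],
  [-4002676736,-6027149312,8027832320,-3197706240,1424604160,-472621824,57213312,3151040,-375380,-366405,72496,-3403],
  [9122611200,11880693760,-8265154560,3497144320,-1582295040,415467520,-35091840,-3430320,-180860,354495,-54360,2305],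
  [4267180032,6312689664,-4298833920,1575219200,-710272000,169937408,-9932864,-1709440,-208900,158575,-18512,641],
  [479199232,2329411584,-3486842880,1327964160,-594380800,201171968,-24525824,-1396960,173920,157400,-30592,1416],
  [5011406848,10757472256,-7050608640,2967756800,-1272391680,302724352,-20914496,-2559280,-304100,272365,-36888,1459],
  [-525336576,9062187008,-5951488000,2383298560,-1021327360,271335936,-24048768,-2072000,-98680,231780,-36024,1532],
  [7292059648,19178520576,-13677690880,5775114240,-2460247040,641473792,-56356736,-4845760,-265220,547645,-86008,3699],
  [-7376732160,-6414008320,8782725120,-3689349120,1673528320,-528636160,59760320,3817840,-296240,-419035,78420,-3605]]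
def Tl : List (List (List ℤ)) := [[[1,0,0,0,0,0,0,0,0,0,0,0],[0,1,0,0,0,0,0,0,0,0,0,0],[0,0,1,0,0,0,0,0,0,0,0,0],[0,0,0,1,0,0,0,0,0,0,0,0],[0,0,0,0,1,0,0,0,0,0,0,0],[0,0,0,0,0,1,0,0,0,0,0,0],[0,0,0,0,0,0,1,0,0,0,0,0],[0,0,0,0,0,0,0,1,0,0,0,0],[0,0,0,0,0,0,0,0,1,0,0,0],[0,0,0,0,0,0,0,0,0,1,0,0],[0,0,0,0,0,0,0,0,0,0,1,0],[0,0,0,0,0,0,0,0,0,0,0,1]],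
  [[0,1,0,0,0,0,0,0,0,0,0,0],[0,0,1,-1,1,1,-1,0,1,-1,-2,0],[2,-1,-1,-1,-2,0,0,1,-2,-2,2,2],[-4,0,1,-1,1,1,1,0,-1,1,0,0],[0,0,0,1,-1,-1,-1,1,3,-1,-2,0],[-2,-1,0,-1,0,0,0,-2,1,0,-1,1],[0,1,2,-1,0,-1,-1,2,1,-1,1,0],[-6,2,2,1,0,0,0,2,2,0,0,0],[-3,-1,1,-3,0,1,-1,-2,0,1,1,-1],[-2,0,0,-1,0,3,1,0,-1,3,2,0],[-3,-2,-1,-1,2,1,1,0,-1,1,3,0],[-5,1,3,-1,0,1,1,0,2,1,-1,-1]],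
  [[0,0,1,0,0,0,0,0,0,0,0,0],[2,-1,-1,-1,-2,0,0,1,-2,-2,2,2],[5,0,0,2,1,1,-1,-3,1,3,-2,0],[6,-2,-1,2,2,0,-2,-1,0,0,0,0],[0,1,0,2,2,-2,2,-1,0,0,1,0],[0,0,0,2,1,0,1,1,-1,-1,1,0],[1,0,-1,-2,-2,3,2,-2,-1,3,-2,0],[0,1,-1,-1,0,1,1,-2,-1,3,-1,-2],[1,0,2,-1,0,0,0,3,0,-2,1,1],[-3,0,1,1,0,-2,-2,2,1,-1,-1,-1],[6,-1,0,-1,-1,1,-1,-1,-1,-1,1,2],[1,0,0,1,2,0,0,-1,-1,2,-1,0]],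
  [[0,0,0,1,0,0,0,0,0,0,0,0],[-4,0,1,-1,1,1,1,0,-1,1,0,0],[6,-2,-1,2,2,0,-2,-1,0,0,0,0],[2,0,1,3,5,-1,1,-2,1,1,0,-2],[4,-1,0,0,-1,-1,-1,1,1,-1,0,2],[0,-1,0,3,2,0,2,0,1,0,-1,-1],[-3,1,0,-1,-2,2,0,1,0,2,-2,-2],[0,1,-2,0,-2,0,0,0,0,0,0,0],[-5,2,3,0,0,1,1,0,0,1,-1,-1],[-1,1,0,0,0,-2,-2,1,0,-2,1,0],[1,0,1,1,2,1,1,-2,-1,1,-1,0],[-3,2,1,2,2,-3,-1,0,2,1,-1,-1]],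
  [[0,0,0,0,1,0,0,0,0,0,0,0],[0,0,0,1,-1,-1,-1,1,3,-1,-2,0],[0,1,0,2,2,-2,2,-1,0,0,1,0],[4,-1,0,0,-1,-1,-1,1,1,-1,0,2],[-6,2,3,-1,0,1,-1,0,1,1,-1,-2],[-1,0,2,-2,-1,-1,-2,0,2,0,-1,0],[-1,0,-1,-1,-1,0,-1,1,-1,-2,2,1],[-5,0,2,-2,1,2,0,1,0,0,0,0],[4,-4,-3,-1,-2,0,-2,-1,-1,-2,1,2],[1,-1,-1,0,1,2,2,-1,-1,1,1,1],[1,-1,-1,2,1,-2,0,1,2,0,0,0],[2,-2,1,-3,-2,2,-2,1,0,-2,1,1]],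
  [[0,0,0,0,0,1,0,0,0,0,0,0],[-2,-1,0,-1,0,0,0,-2,1,0,-1,1],[0,0,0,2,1,0,1,1,-1,-1,1,0],[0,-1,0,3,2,0,2,0,1,0,-1,-1],[-1,0,2,-2,-1,-1,-2,0,2,0,-1,0],[3,-3,-1,2,1,1,3,-3,1,1,-2,-2],[-2,1,2,-1,-2,1,-1,3,1,-1,0,-1],[-6,0,2,-2,-2,1,-2,2,1,-2,0,1],[5,-2,-2,-1,-2,1,0,-3,-2,0,1,0],[-2,1,0,-2,-1,1,-2,0,-1,0,1,2],[0,-1,-1,2,2,0,2,-1,0,0,0,0],[-2,0,2,-3,-2,-2,-3,0,1,-1,0,2]],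
  [[0,0,0,0,0,0,1,0,0,0,0,0],[0,1,2,-1,0,-1,-1,2,1,-1,1,0],[1,0,-1,-2,-2,3,2,-2,-1,3,-2,0],[-3,1,0,-1,-2,2,0,1,0,2,-2,-2],[-1,0,-1,-1,-1,0,-1,1,-1,-2,2,1],[-2,1,2,-1,-2,1,-1,3,1,-1,0,-1],[6,-1,-1,0,1,2,2,-4,-2,1,1,2],[3,0,-1,2,2,0,1,-2,0,2,-1,0],[-2,0,1,0,1,-1,1,1,1,-2,1,0],[-3,0,0,2,1,-1,1,0,0,1,-2,0],[1,1,1,-2,-1,0,0,1,1,0,0,-1],[-2,1,0,-2,-2,2,0,-1,-2,1,0,2]],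
  [[0,0,0,0,0,0,0,1,0,0,0,0],[-6,2,2,1,0,0,0,2,2,0,0,0],[0,1,-1,-1,0,1,1,-2,-1,3,-1,-2],[0,1,-2,0,-2,0,0,0,0,0,0,0],[-5,0,2,-2,1,2,0,1,0,0,0,0],[-6,0,2,-2,-2,1,-2,2,1,-2,0,1],[3,0,-1,2,2,0,1,-2,0,2,-1,0],[4,0,0,0,2,1,-1,1,1,1,-1,0],[-3,-1,1,0,-3,-1,-1,1,2,-3,-1,2],[1,1,0,2,1,-2,0,2,1,-1,-1,-1],[0,2,0,0,-2,0,0,0,0,0,-1,0],[-1,-1,-1,0,-1,1,-1,1,1,-1,-1,1]],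
  [[0,0,0,0,0,0,0,0,1,0,0,0],[-3,-1,1,-3,0,1,-1,-2,0,1,1,-1],[1,0,2,-1,0,0,0,3,0,-2,1,1],[-5,2,3,0,0,1,1,0,0,1,-1,-1],[4,-4,-3,-1,-2,0,-2,-1,-1,-2,1,2],[5,-2,-2,-1,-2,1,0,-3,-2,0,1,0],[-2,0,1,0,1,-1,1,1,1,-2,1,0],[-3,-1,1,0,-3,-1,-1,1,2,-3,-1,2],[3,1,-2,2,2,-2,2,-4,-1,2,0,-3],[0,2,2,-1,-1,1,0,-1,1,1,-3,1],[-2,2,2,0,1,-1,-1,1,1,-1,-1,-2],[0,0,0,-1,-2,-1,1,-3,-1,-1,1,2]],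
  [[0,0,0,0,0,0,0,0,0,1,0,0],[-2,0,0,-1,0,3,1,0,-1,3,2,0],[-3,0,1,1,0,-2,-2,2,1,-1,-1,-1],[-1,1,0,0,0,-2,-2,1,0,-2,1,0],[1,-1,-1,0,1,2,2,-1,-1,1,1,1],[-2,1,0,-2,-1,1,-2,0,-1,0,1,2],[-3,0,0,2,1,-1,1,0,0,1,-2,0],[1,1,0,2,1,-2,0,2,1,-1,-1,-1],[0,2,2,-1,-1,1,0,-1,1,1,-3,1],[5,2,0,3,1,-3,-1,1,2,-2,-4,-3],[3,3,2,-1,-3,0,-2,0,-1,-2,-3,1],[-2,0,-1,4,2,0,1,1,1,0,-2,-2]],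
  [[0,0,0,0,0,0,0,0,0,0,1,0],[-3,-2,-1,-1,2,1,1,0,-1,1,3,0],[6,-1,0,-1,-1,1,-1,-1,-1,-1,1,2],[1,0,1,1,2,1,1,-2,-1,1,-1,0],[1,-1,-1,2,1,-2,0,1,2,0,0,0],[0,-1,-1,2,2,0,2,-1,0,0,0,0],[1,1,1,-2,-1,0,0,1,1,0,0,-1],[0,2,0,0,-2,0,0,0,0,0,-1,0],[-2,2,2,0,1,-1,-1,1,1,-1,-1,-2],[3,3,2,-1,-3,0,-2,0,-1,-2,-3,1],[4,1,0,1,1,-1,-1,-1,-1,-3,-2,0],[0,2,2,0,1,-1,1,-1,1,1,-1,0]],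
  [[0,0,0,0,0,0,0,0,0,0,0,1],[-5,1,3,-1,0,1,1,0,2,1,-1,-1],[1,0,0,1,2,0,0,-1,-1,2,-1,0],[-3,2,1,2,2,-3,-1,0,2,1,-1,-1],[2,-2,1,-3,-2,2,-2,1,0,-2,1,1],[-2,0,2,-3,-2,-2,-3,0,1,-1,0,2],[-2,1,0,-2,-2,2,0,-1,-2,1,0,2],[-1,-1,-1,0,-1,1,-1,1,1,-1,-1,1],[0,0,0,-1,-2,-1,1,-3,-1,-1,1,2],[-2,0,-1,4,2,0,1,1,1,0,-2,-2],[0,2,2,0,1,-1,1,-1,1,1,-1,0],[-1,-1,0,2,-2,2,0,0,1,0,-2,-1]]]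
def bl : List ℤ := [1,0,1,-1,0,1,-1,0,1,1,-1,0]
def trl : List ℤ := [12,3,3,-3,0,3,3,6,3,0,-3,-3]
def TMl : List (List ℤ) := [[12,3,3,-3,0,3,3,6,3,0,-3,-3],
  [3,15,9,-39,12,-33,18,-45,-39,-18,-48,-27],
  [3,9,45,45,-12,-3,21,3,33,-27,54,3],
  [-3,-39,45,15,42,3,-6,-3,-33,-18,6,-33],
  [0,12,-12,42,-42,0,-21,-36,6,3,6,30],
  [3,-33,-3,3,0,27,12,-51,27,-30,-12,-27],
  [3,18,21,-6,-21,12,39,21,-15,-36,36,-27],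
  [6,-45,3,-3,-36,-51,21,60,-33,24,9,-9],
  [3,-39,33,-33,6,27,-15,-33,9,21,0,-27],
  [0,-18,-27,-18,3,-30,-36,24,21,78,51,-15],
  [-3,-48,54,6,6,-12,36,9,0,51,39,12],
  [-3,-27,3,-33,30,-27,-27,-9,-27,-15,12,-3]]

theorem chk_Rel : Wl.map (fun x => Wl.map (mulM 12 (Fl.map Neg.neg) x)) =
    Tl.map (List.map fun t => smulL NN (lc Wl t)) := by decide +kernel
theorem chk_b : lc Wl bl = [0, NN, 0, 0, 0, 0, 0, 0, 0, 0, 0, 0] := by decide +kernel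

def Φ2 : List (List ℤ) := [[1,0,0,0,0,0,0,0,0,0,0,0],
  [0,0,1,1,1,1,1,0,1,1,0,0],
  [1,0,0,0,1,1,1,1,1,1,0,0],
  [0,0,1,1,1,1,1,0,1,1,0,0],
  [0,0,1,1,0,1,1,0,1,1,1,0],
  [1,1,1,0,1,1,1,1,1,1,0,0],
  [0,1,1,0,1,0,0,0,0,1,1,0],
  [0,0,0,0,0,1,1,1,1,1,1,0],
  [1,1,0,0,0,0,0,0,1,0,0,1],
  [1,0,0,1,1,1,1,1,0,0,0,1],
  [0,1,0,1,1,1,1,1,1,1,0,0],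
  [1,1,0,0,0,0,0,0,1,0,0,1]]
def U2 : List (List ℤ) := [[0,0,0,0,0,0,0,0,0,0,0,0],
  [1,0,1,0,1,0,0,0,0,0,0,1],
  [1,0,1,0,0,1,0,0,0,0,0,0],
  [0,0,1,0,0,0,0,0,0,0,0,1],
  [1,1,1,0,0,0,0,0,1,0,0,1],
  [0,0,1,0,0,0,1,0,0,0,0,0],
  [0,1,0,0,1,0,1,0,1,0,0,0],
  [0,0,0,0,1,1,0,0,1,0,0,0],
  [0,1,1,0,1,1,0,0,0,0,0,1],
  [0,1,1,0,0,0,0,0,1,0,0,0],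
  [1,1,1,0,0,0,0,0,0,0,0,0],
  [1,0,1,0,0,1,0,0,0,0,0,1]]
def π2 : List ℤ := [0,0,0,0,0,0,0,-1,-1,0,1,0]
def Q2 : List ℤ := [-65,-4,30,374,971,-85,571,-451,-226,400,-24,-259]
theorem chk_2 : tmul Tl π2 [653,-375,-92,835,165,864,860,98,204,168,-377,-952] = addL (smulL (55 * ((2 : ℕ) : ℤ)) [1]) (smulL 0 π2) ∧
    tpow Tl π2 4 = smulL ((2 : ℕ) : ℤ) Q2 ∧
    (∀ i < 12, Φ2.getD i [] = rowPow ((2 : ℕ) : ℤ) (Tl.getD i []) (ee i) (2 - 1)) ∧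
    (∀ i < 12, modL ((2 : ℕ) : ℤ) (lc Φ2 (Φ2.getD i [])) = modL ((2 : ℕ) : ℤ) (addL (ee i) (tmul Tl (U2.getD i []) π2))) := by
  decide +kernel
def Φ3 : List (List ℤ) := [[1,0,0,0,0,0,0,0,0,0,0,0],
  [0,0,2,1,1,1,1,2,2,2,0,2],
  [0,2,0,2,2,2,2,2,2,2,0,0],
  [2,1,1,2,2,2,1,0,0,0,1,1],
  [2,1,1,1,1,1,2,1,1,1,2,1],
  [0,2,0,0,0,0,1,1,1,1,2,0],
  [1,2,0,0,0,0,1,1,1,1,2,0],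
  [1,1,2,0,0,0,1,2,2,2,2,2],
  [0,0,2,1,1,1,1,2,2,2,0,2],
  [0,0,1,0,0,0,1,0,0,0,2,1],
  [1,0,0,0,0,0,0,0,0,0,0,0],
  [1,1,0,2,2,2,0,0,0,0,2,0]]
def U3 : List (List ℤ) := [[0,0,0,0,0,0,0,0,0,0,0,0],
  [0,0,2,2,0,0,2,1,2,0,0,0],
  [0,1,2,0,1,2,0,0,0,0,0,0],
  [0,2,0,2,2,1,2,1,0,0,0,0],
  [0,1,1,2,2,1,1,1,0,0,0,0],
  [1,0,0,0,0,0,0,0,0,0,0,0],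
  [1,1,1,2,0,1,0,1,0,1,0,0],
  [0,1,0,1,1,0,1,0,2,2,0,0],
  [1,0,2,2,0,0,1,1,1,1,0,0],
  [2,0,1,2,2,0,1,2,0,2,0,0],
  [2,0,1,1,2,1,2,2,2,0,0,0],
  [1,2,0,1,0,2,0,1,0,0,0,0]]
def π3 : List ℤ := [1,0,0,0,0,-1,0,0,0,0,0,0]
def Q3 : List ℤ := [-18,170,-220,238,148,454,168,181,-282,8,192,-22]
theorem chk_3 : tmul Tl π3 [15,0,-1,-19,-14,6,1,3,-6,-9,5,9] = addL (smulL (11 * ((3 : ℕ) : ℤ)) [1]) (smulL 0 π3) ∧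
    tpow Tl π3 5 = smulL ((3 : ℕ) : ℤ) Q3 ∧
    (∀ i < 12, Φ3.getD i [] = rowPow ((3 : ℕ) : ℤ) (Tl.getD i []) (ee i) (3 - 1)) ∧
    (∀ i < 12, modL ((3 : ℕ) : ℤ) (lc Φ3 (Φ3.getD i [])) = modL ((3 : ℕ) : ℤ) (addL (ee i) (tmul Tl (U3.getD i []) π3))) := by
  decide +kernel
def Φ5 : List (List ℤ) := [[1,0,0,0,0,0,0,0,0,0,0,0],
  [4,0,2,0,0,1,3,3,1,4,4,4],
  [1,4,1,1,4,3,3,0,4,2,1,1],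
  [2,1,2,4,1,1,3,0,0,0,1,1],
  [3,0,1,0,0,3,3,2,3,3,3,3],
  [2,3,0,2,3,0,0,1,2,3,1,1],
  [1,2,4,3,2,2,1,0,0,0,2,2],
  [0,2,4,3,2,2,1,0,0,0,2,2],
  [3,3,2,2,3,1,1,0,3,4,2,2],
  [1,2,2,3,2,1,0,1,4,4,1,1],
  [3,2,1,3,2,3,4,3,1,4,1,1],
  [0,2,2,3,2,1,4,4,4,0,2,2]]
def U5 : List (List ℤ) := [[0,0,0,0,0,0,0,0,0,0,0,0],
  [3,4,1,4,2,2,2,0,3,0,1,0],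
  [1,0,1,3,1,4,3,2,1,0,1,0],
  [3,3,1,3,2,2,4,0,2,0,0,0],
  [3,1,3,3,0,1,4,1,2,0,3,0],
  [4,3,1,4,2,3,0,4,3,0,2,0],
  [4,2,1,4,0,0,4,4,3,0,2,0],
  [1,3,0,3,1,2,2,2,1,0,1,0],
  [0,2,0,2,4,3,3,3,4,0,4,0],
  [0,4,4,3,0,2,2,1,2,0,4,0],
  [1,0,4,1,4,1,3,3,2,0,1,0],
  [0,3,3,2,1,3,1,1,3,0,0,0]]
def π5 : List ℤ := [2,0,0,0,0,0,0,-1,-1,0,0,0]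
def Q5 : List ℤ := [11426514,11592939,4823598,4313325,-1811601,-4612197,-4889733,2808015,2795199,-9613347,-15688716,-445146]
theorem chk_5 : tmul Tl π5 [1009,-172,-424,842,738,43,749,-275,325,95,-97,-592] = addL (smulL (906 * ((5 : ℕ) : ℤ)) [1]) (smulL 0 π5) ∧
    tpow Tl π5 10 = smulL ((5 : ℕ) : ℤ) Q5 ∧
    (∀ i < 12, Φ5.getD i [] = rowPow ((5 : ℕ) : ℤ) (Tl.getD i []) (ee i) (5 - 1)) ∧
    (∀ i < 12, modL ((5 : ℕ) : ℤ) (lc Φ5 (Φ5.getD i [])) = modL ((5 : ℕ) : ℤ) (addL (ee i) (tmul Tl (U5.getD i []) π5))) := by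
  decide +kernel
def Φ11 : List (List ℤ) := [[1,0,0,0,0,0,0,0,0,0,0,0],
  [7,8,7,8,2,9,9,10,2,8,4,4],
  [1,8,6,9,4,3,8,3,1,7,7,8],
  [3,9,5,9,5,0,3,7,8,10,1,9],
  [3,10,2,9,1,2,10,3,5,2,4,1],
  [6,0,3,3,0,8,5,3,0,2,7,2],
  [10,3,9,9,7,8,7,3,7,4,5,10],
  [4,4,3,0,1,7,6,2,8,0,3,10],
  [9,10,2,8,10,6,4,4,3,2,3,2],
  [3,3,9,5,8,6,10,1,3,3,9,9],
  [8,1,9,7,0,6,1,6,9,9,0,9],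
  [8,5,7,6,5,1,2,4,6,2,1,0]]
def U11 : List (List ℤ) := [[0,0,0,0,0,0,0,0,0,0,0,0],
  [9,7,3,9,3,0,0,0,0,0,0,0],
  [2,3,0,10,3,9,0,0,0,0,0,0],
  [10,3,0,7,6,9,0,0,0,0,0,0],
  [4,8,1,4,0,6,0,0,0,0,0,0],
  [10,8,2,2,2,8,0,0,0,0,0,0],
  [10,10,3,5,3,1,0,0,0,0,0,0],
  [0,10,2,3,1,0,0,0,0,0,0,0],
  [4,7,2,5,3,10,0,0,0,0,0,0],
  [10,6,8,7,2,3,0,0,0,0,0,0],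
  [7,6,2,8,4,8,0,0,0,0,0,0],
  [9,2,5,8,3,1,0,0,0,0,0,0]]
def π11 : List ℤ := [-4,1,4,-8,-5,4,0,0,0,0,0,1]
def Q11 : List ℤ := [-106,-4,20,-260,-296,208,62,-42,-111,24,-28,125]
theorem chk_11 : tmul Tl π11 [2435,1294,373,461,-594,-667,-649,-176,69,-1399,-2207,-56] = addL (smulL (116 * ((11 : ℕ) : ℤ)) [1]) (smulL 0 π11) ∧
    tpow Tl π11 2 = smulL ((11 : ℕ) : ℤ) Q11 ∧
    (∀ i < 12, Φ11.getD i [] = rowPow ((11 : ℕ) : ℤ) (Tl.getD i []) (ee i) (11 - 1)) ∧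
    (∀ i < 12, modL ((11 : ℕ) : ℤ) (lc Φ11 (Φ11.getD i [])) = modL ((11 : ℕ) : ℤ) (addL (ee i) (tmul Tl (U11.getD i []) π11))) := by
  decide +kernel
end M11

namespace M11
open Polynomial NumberField

section fld
variable {K : Type*} [Field K] [CharZero K]

theorem pow12' (y : K) (hy : ev y (Fl ++ [1]) = 0) : y ^ 12 = ev y (Fl.map Neg.neg) := by
  simp only [Fl, List.cons_append, List.nil_append, ev_cons, ev_nil, List.map_cons, List.map_nil] at hy ⊢
  push_cast at hy ⊢
  linear_combination hy

def wl (b : K) : List K := Wl.map fun l => ev b l * (NN : K)⁻¹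

theorem NN_ne : (NN : K) ≠ 0 := by
  have : NN ≠ 0 := by decide
  exact_mod_cast this

theorem lin_wl (b : K) (c : List ℤ) : lin (wl b) c = ev b (lc Wl c) * (NN : K)⁻¹ := by
  rw [ev_lc, ← lin_mul', wl, List.map_map]
  rfl

theorem Rel_wl (b : K) (hb : ev b (Fl ++ [1]) = 0) : Rel Tl (wl b) := by
  have hh := congrArg (List.map (List.map fun l => ev b l * (NN : K)⁻¹ * (NN : K)⁻¹)) chk_Rel
  simp only [List.map_map] at hh
  unfold Rel
  simp only [wl, List.map_map]
  rw [← wl]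
  symm
  convert hh using 2
  · funext l
    simp only [Function.comp_apply, List.map_map]
    congr 1
    funext m
    simp only [Function.comp_apply]
    rw [ev_mulM b 12 _ _ _ (pow12' b hb)]
    ring
  · funext l
    simp only [Function.comp_apply, List.map_map]
    congr 1
    funext m
    simp only [Function.comp_apply]
    rw [lin_wl, ev_smulL]
    have := NN_ne (K := K)
    field_simp

theorem wl_one (b : K) : lin (wl b) [1] = 1 := by
  rw [lin_wl]
  have h : lc Wl [1] = [NN, 0, 0, 0, 0, 0, 0, 0, 0, 0, 0, 0] := by decide
  rw [h]
  simp [mul_inv_cancel₀ (NN_ne (K := K))]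

theorem wl_b (b : K) : lin (wl b) bl = b := by
  rw [lin_wl, chk_b]
  simp [mul_assoc, mul_inv_cancel₀ (NN_ne (K := K))]

theorem wl_len (b : K) : (wl b).length = 12 := by
  rw [wl, List.length_map]; rfl

variable (b : K) (hb : ev b (Fl ++ [1]) = 0)

theorem strip (p : ℕ) (hp : p ∈ ({2, 3, 5, 11} : Finset ℕ)) (x : K) (hx : IsIntegral ℤ x)
    (h2 : (p : K) * x ∈ ordS (Rel_wl b hb) (wl_one b)) : x ∈ ordS (Rel_wl b hb) (wl_one b) := by
  have H := @max_prime K _ _ Tl (wl b) (Rel_wl b hb) (wl_one b) (wl_len b)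
  simp only [Finset.mem_insert, Finset.mem_singleton] at hp
  rcases hp with rfl | rfl | rfl | rfl
  · exact H 2 (by norm_num) π2 _ Q2 _ _ Φ2 U2 (by rw [Int.isCoprime_iff_gcd_eq_one]; decide) (by decide) chk_2.1
      chk_2.2.1 rfl chk_2.2.2.1 chk_2.2.2.2 x hx h2
  · exact H 3 (by norm_num) π3 _ Q3 _ _ Φ3 U3 (by rw [Int.isCoprime_iff_gcd_eq_one]; decide) (by decide) chk_3.1
      chk_3.2.1 rfl chk_3.2.2.1 chk_3.2.2.2 x hx h2
  · exact H 5 (by norm_num) π5 _ Q5 _ _ Φ5 U5 (by rw [Int.isCoprime_iff_gcd_eq_one]; decide) (by decide) chk_5.1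
      chk_5.2.1 rfl chk_5.2.2.1 chk_5.2.2.2 x hx h2
  · exact H 11 (by norm_num) π11 _ Q11 _ _ Φ11 U11 (by rw [Int.isCoprime_iff_gcd_eq_one]; decide) (by decide) chk_11.1
      chk_11.2.1 rfl chk_11.2.2.1 chk_11.2.2.2 x hx h2

theorem strip_pow (p : ℕ) (hp : p ∈ ({2, 3, 5, 11} : Finset ℕ)) (n : ℕ) (x : K) (hx : IsIntegral ℤ x)
    (h2 : (p : K) ^ n * x ∈ ordS (Rel_wl b hb) (wl_one b)) : x ∈ ordS (Rel_wl b hb) (wl_one b) := by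
  induction n with
  | zero => simpa using h2
  | succ n ih =>
    apply ih
    apply strip b hb p hp
    · exact (map_natCast (algebraMap ℤ K) p ▸ isIntegral_algebraMap (R := ℤ) (A := K) (x := (p : ℤ))).pow n |>.mul hx
    · rwa [← mul_assoc, ← pow_succ']

theorem strip_all (x : K) (hx : IsIntegral ℤ x)
    (h2 : ((2 ^ 8 * 3 ^ 12 * 5 ^ 10 * 11 ^ 6 : ℤ) : K) * x ∈ ordS (Rel_wl b hb) (wl_one b)) :
    x ∈ ordS (Rel_wl b hb) (wl_one b) := by
  have hi : ∀ (m : ℕ), IsIntegral ℤ (m : K) := fun m => by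
    have := isIntegral_algebraMap (R := ℤ) (A := K) (x := (m : ℤ))
    simpa using this
  have h11 := ((hi 11).pow 6).mul hx
  have h5 := ((hi 5).pow 10).mul h11
  have h3 := ((hi 3).pow 12).mul h5
  apply strip_pow b hb 11 (by decide) 6 x hx
  apply strip_pow b hb 5 (by decide) 10 _ h11
  apply strip_pow b hb 3 (by decide) 12 _ h5
  apply strip_pow b hb 2 (by decide) 8 _ h3
  convert h2 using 1
  push_cast
  ring
end fld
end M11

namespace M11
open Polynomial NumberField

def Ll : List (List ℤ) := [[1,0,0,0,0,0,0,0,0,0,0,0],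
  [-1,4,0,0,0,0,0,0,0,0,0,0],
  [-2,-11,19,0,0,0,0,0,0,0,0,0],
  [-6,92,-43,25,0,0,0,0,0,0,0,0],
  [-6,-136,71,-89,-171,0,0,0,0,0,0,0],
  [26,88,-73,87,133,-32,0,0,0,0,0,0],
  [180,-41,-349,306,287,-238,214,0,0,0,0,0],
  [-30,113,7,12,79,94,-22,-30,0,0,0,0],
  [-47,-20,139,-133,-107,20,-128,-1,46,0,0,0],
  [-1,8,-7,37,23,28,80,-23,-22,72,0,0],
  [1,-2,1,-9,-5,-7,-19,5,5,-17,1,0],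
  [-3,2,1,3,-1,1,1,1,1,3,-3,-4]]
def Ul : List (List ℤ) := [[12,3,3,-3,0,3,3,6,3,0,-3,-3],
  [0,57,33,-153,48,-135,69,-186,-159,-72,-189,-105],
  [0,0,750,1290,-360,300,195,540,1050,-315,1560,360],
  [0,0,0,-5130,2670,-2850,585,-4380,-5850,-945,-6570,-3420],
  [0,0,0,0,960,3990,3150,12720,9540,1620,8820,1710],
  [0,0,0,0,0,-3210,-3570,-7440,-8700,180,-6540,-690],
  [0,0,0,0,0,0,-9900,7260,-27390,4950,-3300,-1320],
  [0,0,0,0,0,0,0,-15180,-330,-4950,-6600,-2640],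
  [0,0,0,0,0,0,0,0,11880,3630,2310,3960],
  [0,0,0,0,0,0,0,0,0,330,5610,-3960],
  [0,0,0,0,0,0,0,0,0,0,-1320,990],
  [0,0,0,0,0,0,0,0,0,0,0,-330]]

def mat (l : List (List ℤ)) : Matrix (Fin 12) (Fin 12) ℤ := Matrix.of fun i j => (l.getD i []).getD j 0

theorem det_TM : (mat TMl).det = 2 ^ 8 * 3 ^ 12 * 5 ^ 10 * 11 ^ 6 := by
  have h1 : mat Ll * mat TMl = mat Ul := by
    have h : ∀ i j : Fin 12, ((List.finRange 12).map fun k : Fin 12 =>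
        (Ll.getD i []).getD k 0 * (TMl.getD k []).getD j 0).sum = (Ul.getD i []).getD j 0 := by decide +kernel
    ext i j
    rw [Matrix.mul_apply, Fin.sum_univ_def]
    exact h i j
  have h2 : (mat Ll).det = ∏ i, mat Ll i i := by
    apply Matrix.det_of_isLowerTriangular
    have h : ∀ i j : Fin 12, i < j → (Ll.getD i []).getD j 0 = 0 := by decide +kernel
    intro i j hij
    exact h i j hij
  have h3 : (mat Ul).det = ∏ i, mat Ul i i := by
    apply Matrix.det_of_isUpperTriangular
    have h : ∀ i j : Fin 12, j < i → (Ul.getD i []).getD j 0 = 0 := by decide +kernel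
    intro i j hij
    exact h i j hij
  have h4 := congrArg Matrix.det h1
  rw [Matrix.det_mul, h2, h3] at h4
  have h5 : ∏ i, mat Ll i i ≠ 0 := by
    simp only [Fin.prod_univ_succ, Fin.prod_univ_zero]
    decide +kernel
  have h6 : ∏ i, mat Ul i i = (∏ i, mat Ll i i) * (2 ^ 8 * 3 ^ 12 * 5 ^ 10 * 11 ^ 6) := by
    simp only [Fin.prod_univ_succ, Fin.prod_univ_zero]
    decide +kernel
  exact mul_left_cancel₀ h5 (h4.trans h6)

theorem discr_of {K : Type*} [Field K] [NumberField K] {ι : Type*} [Fintype ι] [DecidableEq ι]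
    (B : Module.Basis ι ℚ K) (hB : ∀ i, IsIntegral ℤ (B i))
    (hx : ∀ x : K, IsIntegral ℤ x → x ∈ Submodule.span ℤ (Set.range B)) (d : ℤ)
    (hd : Algebra.discr ℚ B = d) : discr K = d := by
  let w : ι → 𝓞 K := fun i => ⟨B i, hB i⟩
  have hw : ∀ i, algebraMap (𝓞 K) K (w i) = B i := fun i => rfl
  have hli : LinearIndependent ℤ w := by
    apply LinearIndependent.of_comp ((Algebra.linearMap (𝓞 K) K).restrictScalars ℤ)
    exact B.linearIndependent.restrict_scalars' ℤ
  have hsp : ⊤ ≤ Submodule.span ℤ (Set.range w) := by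
    intro x _
    have h1 := hx (x : K) x.isIntegral_coe
    rw [Submodule.mem_span_range_iff_exists_fun] at h1 ⊢
    obtain ⟨c, hc⟩ := h1
    refine ⟨c, ?_⟩
    apply RingOfIntegers.ext
    rw [← hc]
    simp [hw]
  let b := Module.Basis.mk hli hsp
  rw [← NumberField.discr_eq_discr K b, ← Rat.intCast_inj, ← hd]
  change algebraMap ℤ ℚ _ = _
  rw [← Algebra.discr_localizationLocalization ℤ (nonZeroDivisors ℤ) K]
  congr 1
  ext i
  rw [Module.Basis.localizationLocalization_apply, Module.Basis.mk_apply, hw]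
end M11

namespace M11
open Polynomial NumberField

theorem Rel.get {R : Type*} [CommRing R] {T : List (List (List ℤ))} {v : List R} (h : Rel T v) (i j : ℕ)
    (hi : i < v.length) (hj : j < v.length) :
    lin v ((T.getD i []).getD j []) = v.getD i 0 * v.getD j 0 := by
  have hT : T.length = v.length := by simpa using congrArg List.length h
  have h1 := congrArg (fun l => l.getD i []) h
  rw [List.getD_eq_getElem _ _ (by simpa [hT] using hi), List.getD_eq_getElem _ _ (by simpa using hi),
    List.getElem_map, List.getElem_map] at h1
  have hTi : T[i].length = v.length := by simpa using congrArg List.length h1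
  have h2 := congrArg (fun l => l.getD j 0) h1
  rw [List.getD_eq_getElem _ _ (by simpa [hTi] using hj), List.getD_eq_getElem _ _ (by simpa using hj),
    List.getElem_map, List.getElem_map] at h2
  rw [List.getD_eq_getElem T [] (by omega), List.getD_eq_getElem _ _ hi, List.getD_eq_getElem _ _ hj,
    List.getD_eq_getElem _ _ (by omega), h2]

def Tc (i j k : ℕ) : ℤ := ((Tl.getD i []).getD j []).getD k 0

theorem chk_tr : ∀ i : Fin 12, ((List.finRange 12).map fun j : Fin 12 => Tc i j j).sum = trl.getD i 0 := by decide +kernel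

theorem chk_TM : ∀ i j : Fin 12, ((List.finRange 12).map fun k : Fin 12 => Tc i j k * trl.getD k 0).sum =
    (TMl.getD i []).getD j 0 := by decide +kernel

section
variable {K : Type*} [Field K] [NumberField K]

def ww (b : K) (i : Fin 12) : K := (wl b).getD i 0

theorem wl_ofFn (b : K) : wl b = List.ofFn (ww b) := by
  apply List.ext_getElem (by simp [wl_len])
  intro i hi hi'
  rw [List.getElem_ofFn, ww, List.getD_eq_getElem _ _ hi]

theorem lin_ww (b : K) (c : List ℤ) : lin (wl b) c = ∑ i : Fin 12, ((c.getD (i : ℕ) 0 : ℤ) : K) * ww b i := by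
  rw [wl_ofFn, lin_ofFn]

theorem ww_mul (b : K) (hb : ev b (Fl ++ [1]) = 0) (i j : Fin 12) :
    ww b i * ww b j = ∑ k : Fin 12, (Tc i j k : K) * ww b k := by
  have := (Rel_wl b hb).get i j (by rw [wl_len]; exact i.2) (by rw [wl_len]; exact j.2)
  rw [lin_ww] at this
  exact this.symm

variable (b : K) (hb : ev b (Fl ++ [1]) = 0) (B : Module.Basis (Fin 12) ℚ K) (hB : ∀ i, B i = ww b i)
include hb hB

theorem repr_mul (i j k : Fin 12) : B.repr (B i * B j) k = Tc i j k := by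
  have : B i * B j = ∑ k : Fin 12, (Tc i j k : ℚ) • B k := by
    simp only [hB]
    rw [ww_mul b hb]
    apply Finset.sum_congr rfl
    intro k _
    rw [Algebra.smul_def]; simp
  rw [this, Module.Basis.repr_sum_self]

theorem trace_B (i : Fin 12) : Algebra.trace ℚ K (B i) = (trl.getD i 0 : ℤ) := by
  rw [Algebra.trace_eq_matrix_trace B, Matrix.trace]
  simp only [Matrix.diag_apply, Algebra.leftMulMatrix_eq_repr_mul, repr_mul b hb B hB]
  rw [← chk_tr, ← Fin.sum_univ_def]
  push_cast; rfl

theorem trace_BB (i j : Fin 12) : Algebra.trace ℚ K (B i * B j) = (mat TMl i j : ℤ) := by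
  rw [← B.sum_repr (B i * B j), map_sum]
  simp only [map_smul, repr_mul b hb B hB, trace_B b hb B hB, smul_eq_mul]
  change _ = (((TMl.getD i []).getD j 0 : ℤ) : ℚ)
  rw [← chk_TM, ← Fin.sum_univ_def]
  push_cast; rfl

theorem traceMatrix_B : Algebra.traceMatrix ℚ B = (mat TMl).map (Int.cast : ℤ → ℚ) := by
  ext i j
  rw [Algebra.traceMatrix_apply, Algebra.traceForm_apply, trace_BB b hb B hB]
  rfl

theorem discr_B : Algebra.discr ℚ B = ((2 ^ 8 * 3 ^ 12 * 5 ^ 10 * 11 ^ 6 : ℤ) : ℚ) := by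
  rw [Algebra.discr_def, traceMatrix_B b hb B hB, ← det_TM]
  exact ((Int.castRingHom ℚ).map_det (mat TMl)).symm

theorem lin_B (c : List ℤ) : lin (wl b) c ∈ Submodule.span ℤ (Set.range B) := by
  rw [lin_ww]
  apply Submodule.sum_mem
  intro i _
  rw [← zsmul_eq_mul, ← hB]
  exact Submodule.smul_mem _ _ (Submodule.subset_span ⟨i, rfl⟩)

theorem ww_mem (i : Fin 12) : B i ∈ ordS (Rel_wl b hb) (wl_one b) :=
  ⟨ee i, by rw [lin_ee, hB]; rfl⟩

theorem int_mem (x : K) (hx : IsIntegral ℤ x) : x ∈ ordS (Rel_wl b hb) (wl_one b) := by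
  apply strip_all b hb x hx
  have hz : ∀ i, ∃ z : ℤ, (z : ℚ) = Algebra.trace ℚ K (B i * x) := by
    intro i
    have h1 : IsIntegral ℤ (B i * x) := (ordS_int _ _ _ (ww_mem b hb B hB i)).mul hx
    have h2 : IsIntegral ℤ (Algebra.trace ℚ K (B i * x)) := Algebra.isIntegral_trace h1
    exact IsIntegrallyClosed.isIntegral_iff.1 h2
  choose z hz using hz
  set M : Matrix (Fin 12) (Fin 12) ℚ := (mat TMl).map (Int.cast : ℤ → ℚ) with hM
  have h3 : M.mulVec (fun j => B.repr x j) = fun i => (z i : ℚ) := by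
    ext i
    rw [hz]
    conv_rhs => rw [← B.sum_repr x, Finset.mul_sum, map_sum]
    simp only [Matrix.mulVec, dotProduct]
    apply Finset.sum_congr rfl
    intro j _
    rw [mul_smul_comm, map_smul, trace_BB b hb B hB, smul_eq_mul, mul_comm]
    rfl
  have h4 := congrArg (M.adjugate.mulVec) h3
  rw [Matrix.mulVec_mulVec, Matrix.adjugate_mul] at h4
  have hdet : M.det = ((2 ^ 8 * 3 ^ 12 * 5 ^ 10 * 11 ^ 6 : ℤ) : ℚ) := by
    rw [← det_TM]
    exact ((Int.castRingHom ℚ).map_det (mat TMl)).symm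
  have hadj : M.adjugate = (mat TMl).adjugate.map (Int.cast : ℤ → ℚ) :=
    ((Int.castRingHom ℚ).map_adjugate (mat TMl)).symm
  have h5 : ∀ i, M.det * B.repr x i = ((∑ j, (mat TMl).adjugate i j * z j : ℤ) : ℚ) := by
    intro i
    have := congrFun h4 i
    rw [Matrix.smul_mulVec, Matrix.one_mulVec, hadj] at this
    simp only [Matrix.mulVec, dotProduct, Pi.smul_apply, smul_eq_mul, Matrix.map_apply] at this
    rw [this]; push_cast; rfl
  have h6 : ((2 ^ 8 * 3 ^ 12 * 5 ^ 10 * 11 ^ 6 : ℤ) : K) * x =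
      ∑ i, ((∑ j, (mat TMl).adjugate i j * z j : ℤ) : K) * B i := by
    have h7 : ((2 ^ 8 * 3 ^ 12 * 5 ^ 10 * 11 ^ 6 : ℤ) : K) = algebraMap ℚ K M.det := by
      rw [hdet, map_intCast]
    rw [h7, ← Algebra.smul_def]
    conv_lhs => rw [← B.sum_repr x, Finset.smul_sum]
    apply Finset.sum_congr rfl
    intro i _
    rw [smul_smul, h5, Algebra.smul_def, map_intCast]
  rw [h6]
  exact Subring.sum_mem _ fun i _ => Subring.mul_mem _ (intCast_mem _ _) (ww_mem b hb B hB i)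

theorem discr_K : discr K = 2 ^ 8 * 3 ^ 12 * 5 ^ 10 * 11 ^ 6 := by
  apply discr_of B
  · exact fun i => ordS_int _ _ _ (ww_mem b hb B hB i)
  · intro x hx
    obtain ⟨c, rfl⟩ := int_mem b hb B hB x hx
    exact lin_B b hb B hB c
  · exact discr_B b hb B hB
end

theorem field_part (K : Type) [Field K] [NumberField K] (he : Nonempty (AdjoinRoot f1 ≃ₐ[ℚ] K)) :
    Module.finrank ℚ K = 12 ∧ discr K = 2 ^ 8 * 3 ^ 12 * 5 ^ 10 * 11 ^ 6 := by
  obtain ⟨e⟩ := he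
  have hfr : Module.finrank ℚ K = 12 := by
    rw [← e.toLinearEquiv.finrank_eq, (AdjoinRoot.powerBasis f1_monic.ne_zero).finrank,
      AdjoinRoot.powerBasis_dim, f1_deg]
  refine ⟨hfr, ?_⟩
  set a : K := e (AdjoinRoot.root f1) with ha
  have hroot : aeval a f1 = 0 := by
    have h1 : aeval (AdjoinRoot.root f1) f1 = 0 := by
      rw [AdjoinRoot.aeval_eq, AdjoinRoot.mk_self]
    have := congrArg e h1
    rwa [map_zero, ← aeval_algHom_apply] at this
  have hb : ev (4 * a) (Fl ++ [1]) = 0 := (f1_root a).1 hroot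
  set b : K := 4 * a with hbd
  have hmem : b ∈ ordS (Rel_wl b hb) (wl_one b) := ⟨bl, wl_b b⟩
  have hspan : ⊤ ≤ Submodule.span ℚ (Set.range (ww b)) := by
    intro x _
    obtain ⟨q, hq⟩ : ∃ q : ℚ[X], aeval a q = x := by
      obtain ⟨q, hq⟩ := AdjoinRoot.mk_surjective (e.symm x)
      refine ⟨q, ?_⟩
      have := congrArg e hq
      rw [e.apply_symm_apply, ← AdjoinRoot.aeval_eq] at this
      rw [← this, ha]
      exact aeval_algHom_apply (e : AdjoinRoot f1 →ₐ[ℚ] K) _ q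
    rw [← hq, aeval_eq_sum_range]
    apply Submodule.sum_mem
    intro k _
    apply Submodule.smul_mem
    have h2 : a ^ k = ((4 : ℚ)⁻¹ ^ k) • b ^ k := by
      rw [Algebra.smul_def, hbd, mul_pow, map_pow, ← mul_assoc, ← mul_pow]
      simp
    rw [h2]
    apply Submodule.smul_mem
    obtain ⟨c, hc⟩ := Subring.pow_mem _ hmem k
    rw [← hc, lin_ww]
    apply Submodule.sum_mem
    intro i _
    have : ((c.getD (i : ℕ) 0 : ℤ) : K) * ww b i = ((c.getD (i : ℕ) 0 : ℤ) : ℚ) • ww b i := by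
      rw [Algebra.smul_def]; simp
    rw [this]
    exact Submodule.smul_mem _ _ (Submodule.subset_span ⟨i, rfl⟩)
  have hcard : Fintype.card (Fin 12) = Module.finrank ℚ K := by rw [hfr]; rfl
  exact discr_K b hb (basisOfTopLeSpanOfCardEqFinrank (ww b) hspan hcard) (fun i => by simp)

theorem primes_dvd (p : ℕ) (hp : p.Prime) : p ∈ ({2, 3, 5, 11} : Finset ℕ) ↔ p ∣ 7920 := by
  constructor
  · intro h
    simp only [Finset.mem_insert, Finset.mem_singleton] at h
    rcases h with rfl | rfl | rfl | rfl <;> decide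
  · intro h
    have : (7920 : ℕ) = 2 ^ 4 * 3 ^ 2 * 5 * 11 := by norm_num
    rw [this, hp.dvd_mul, hp.dvd_mul, hp.dvd_mul] at h
    simp only [Finset.mem_insert, Finset.mem_singleton]
    rcases h with ((h | h) | h) | h
    · exact Or.inl ((Nat.prime_dvd_prime_iff_eq hp (by norm_num)).1 (hp.dvd_of_dvd_pow h))
    · exact Or.inr (Or.inl ((Nat.prime_dvd_prime_iff_eq hp (by norm_num)).1 (hp.dvd_of_dvd_pow h)))
    · exact Or.inr (Or.inr (Or.inl ((Nat.prime_dvd_prime_iff_eq hp (by norm_num)).1 h)))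
    · exact Or.inr (Or.inr (Or.inr ((Nat.prime_dvd_prime_iff_eq hp (by norm_num)).1 h)))

theorem primes_D (p : ℕ) (hp : p.Prime) (h : (p : ℤ) ∣ 2 ^ 8 * 3 ^ 12 * 5 ^ 10 * 11 ^ 6) :
    p ∈ ({2, 3, 5, 11} : Finset ℕ) := by
  have h : p ∣ 2 ^ 8 * 3 ^ 12 * 5 ^ 10 * 11 ^ 6 := by exact_mod_cast h
  rw [hp.dvd_mul, hp.dvd_mul, hp.dvd_mul] at h
  simp only [Finset.mem_insert, Finset.mem_singleton]
  rcases h with ((h | h) | h) | h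
  · exact Or.inl ((Nat.prime_dvd_prime_iff_eq hp (by norm_num)).1 (hp.dvd_of_dvd_pow h))
  · exact Or.inr (Or.inl ((Nat.prime_dvd_prime_iff_eq hp (by norm_num)).1 (hp.dvd_of_dvd_pow h)))
  · exact Or.inr (Or.inr (Or.inl ((Nat.prime_dvd_prime_iff_eq hp (by norm_num)).1 (hp.dvd_of_dvd_pow h))))
  · exact Or.inr (Or.inr (Or.inr ((Nat.prime_dvd_prime_iff_eq hp (by norm_num)).1 (hp.dvd_of_dvd_pow h))))
end M11

theorem m11_field_ramified_at_group_primes :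
    Irreducible f1 ∧
    IsSimpleGroup f1.Gal ∧ Nat.card f1.Gal = 7920 ∧
    (∀ p : ℕ, p.Prime → (p ∈ ({2, 3, 5, 11} : Finset ℕ) ↔ p ∣ 7920)) ∧
    ∀ (K : Type) [Field K] [NumberField K],
      Nonempty (AdjoinRoot f1 ≃ₐ[ℚ] K) →
      Module.finrank ℚ K = 12 ∧
      NumberField.discr K = 2 ^ 8 * 3 ^ 12 * 5 ^ 10 * 11 ^ 6 ∧
      ∀ p : ℕ, p.Prime → (p : ℤ) ∣ NumberField.discr K →
        p ∈ ({2, 3, 5, 11} : Finset ℕ) := by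
  obtain ⟨h1, h2, h3⟩ := M11.group_part
  refine ⟨h1, h2, h3, M11.primes_dvd, ?_⟩
  intro K _ _ he
  obtain ⟨h4, h5⟩ := M11.field_part K he
  refine ⟨h4, h5, ?_⟩
  intro p hp hd
  rw [h5] at hd
  exact M11.primes_D p hp hd
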